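/- arXiv:1605.09217 — 9 statements merged into one kernel-verified Lean document; each statement's English description precedes it below -/
import Mathlib

section
/- Let R be a commutative Noetherian regular local ring, let p ≥ 1, let f₁, …, f_p ∈ R be a regular sequence and let I = (f₁, …, f_p) be the ideal they generate. Let J be a proper ideal of R with I ⊆ J which has pure codimension p, i.e. every associated prime of the R-module R⧸J has height p. If K denotes the colon ideal I : J, then I : K = J (the double-link of J with respect to the complete intersection I is J itself). -/
open RingTheory.Sequence

/-- The height (codimension) of an ideal: the infimum of the heights of the
prime ideals containing it. For a prime ideal this is its usual height. -/
noncomputable def idealHeight {R : Type*} [CommRing R] (I : Ideal R) : ℕ∞ :=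
  ⨅ (P : PrimeSpectrum R) (_ : I ≤ P.asIdeal), Order.height P

section LocalVanishing

open CategoryTheory Abelian

universe u

variable {R : Type u} [CommRing R]

theorem exists_uniform_notMem_smul_mem {E : Type*} [AddCommGroup E] [Module R E]
    [Module.Finite R E] (Q : Ideal R) [Q.IsPrime] (N : Submodule R E)
    (h : ∀ e : E, ∃ s ∉ Q, s • e ∈ N) : ∃ s ∉ Q, ∀ e : E, s • e ∈ N := by
  classical
  obtain ⟨S, hS⟩ := (Module.Finite.fg_top : (⊤ : Submodule R E).FG)
  choose s hs hsN using h
  refine ⟨∏ e ∈ S, s e, fun hmem ↦ ?_, fun e ↦ ?_⟩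
  · obtain ⟨e, -, he⟩ := (Ideal.IsPrime.prod_mem_iff).mp hmem
    exact hs e he
  · have he : e ∈ Submodule.span R (S : Set E) := hS ▸ Submodule.mem_top
    induction he using Submodule.span_induction with
    | mem x hx =>
      rw [← Finset.prod_erase_mul _ _ (Finset.mem_coe.mp hx), mul_smul]
      exact N.smul_mem _ (hsN x)
    | zero => simp
    | add x y _ _ hx hy => simpa [smul_add] using N.add_mem hx hy
    | smul a x _ hx => rw [smul_comm]; exact N.smul_mem a hx

/-- The Nakayama lemma for the localization of a finite module at a prime, without localizing. -/
theorem exists_notMem_smul_eq_zero_of_smul_mem {E : Type*} [AddCommGroup E] [Module R E]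
    [Module.Finite R E] (Q : Ideal R) [Q.IsPrime] {x : R} (hx : x ∈ Q)
    (h : ∀ e : E, ∃ s ∉ Q, ∃ e' : E, s • e = x • e') : ∃ s ∉ Q, ∀ e : E, s • e = 0 := by
  obtain ⟨s, hs, hsE⟩ := exists_uniform_notMem_smul_mem Q (Q • (⊤ : Submodule R E)) fun e ↦ by
    obtain ⟨s, hs, e', he⟩ := h e
    exact ⟨s, hs, he ▸ Submodule.smul_mem_smul hx Submodule.mem_top⟩
  obtain ⟨p, hp, -, hcoeff, hp0⟩ :=
    LinearMap.exists_monic_and_natDegree_eq_and_coeff_mem_pow_and_aeval_eq_zero R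
      (algebraMap R (Module.End R E) s) Q (by rintro _ ⟨e, rfl⟩; exact hsE e)
  refine ⟨p.eval s, fun hmem ↦ hs ?_, fun e ↦ ?_⟩
  · rw [Polynomial.eval_eq_sum_range, Finset.sum_range_succ, hp.coeff_natDegree, one_mul] at hmem
    refine ‹Q.IsPrime›.mem_of_pow_mem _ ((Q.add_mem_iff_right (Q.sum_mem fun k hk ↦ ?_)).mp hmem)
    have hk : p.natDegree - k ≠ 0 := by have := Finset.mem_range.mp hk; omega
    exact Q.mul_mem_right _ (Ideal.pow_le_self hk (hcoeff k))
  · rw [Polynomial.aeval_algebraMap_apply] at hp0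
    simpa using LinearMap.congr_fun hp0 e

theorem ext_smul_eq_zero_of_smul_eq_zero {X Y : ModuleCat.{u} R} {s : R}
    (hs : ∀ x : X, s • x = 0) {i : ℕ} (e : Ext X Y i) : s • e = 0 := by
  have h : s • 𝟙 X = 0 := by ext x; exact hs x
  rw [← Ext.mk₀_id_comp e, ← Ext.smul_comp, ← Ext.mk₀_smul, h, Ext.mk₀_zero, Ext.zero_comp]

/-- The connecting class of `0 ⟶ M ⟶ M ⟶ M / xM ⟶ 0` and the parts of its long exact sequences
describing the kernel and cokernel of multiplication by `x`. -/
theorem exists_ext_quotSMulTop_one {M : ModuleCat.{u} R} {x : R} (hx : IsSMulRegular M x) :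
    ∃ δ : Ext (ModuleCat.of R (QuotSMulTop x M)) M 1,
      (∀ (C : ModuleCat.{u} R) (n : ℕ) (e : Ext C M (n + 1)), x • e = 0 →
        ∃ e' : Ext C (ModuleCat.of R (QuotSMulTop x M)) n, e'.comp δ rfl = e) ∧
      (∀ (C : ModuleCat.{u} R) (n : ℕ) (e : Ext C (ModuleCat.of R (QuotSMulTop x M)) n),
        e.comp δ (rfl : n + 1 = _) = 0 →
          ∃ (e' : Ext C M n) (g : M ⟶ ModuleCat.of R (QuotSMulTop x M)),
            e'.comp (Ext.mk₀ g) (add_zero n) = e) ∧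
      ∀ (Y : ModuleCat.{u} R) (n : ℕ) (e : Ext M Y n), δ.comp e (add_comm 1 n) = 0 →
        ∃ e' : Ext M Y n, e = x • e' := by
  have hS := hx.smulShortComplex_shortExact
  have hcomp (C : ModuleCat.{u} R) (n : ℕ) (e : Ext C M n) :
      e.comp (Ext.mk₀ (x • 𝟙 M)) (add_zero n) = x • e := by
    rw [Ext.mk₀_smul, Ext.comp_smul, Ext.comp_mk₀_id]
  have hcomp' (Y : ModuleCat.{u} R) (n : ℕ) (e : Ext M Y n) :
      (Ext.mk₀ (x • 𝟙 M)).comp e (zero_add n) = x • e := by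
    rw [Ext.mk₀_smul, Ext.smul_comp, Ext.mk₀_id_comp]
  refine ⟨hS.extClass, fun C n e he ↦ Ext.covariant_sequence_exact₁ C hS e
    ((hcomp C _ e).trans he) rfl, fun C n e he ↦ ?_, fun Y n e he ↦ ?_⟩
  · obtain ⟨e', he'⟩ := Ext.covariant_sequence_exact₃ C hS e rfl he
    exact ⟨e', _, he'⟩
  · obtain ⟨e', he'⟩ := Ext.contravariant_sequence_exact₁ hS Y e (add_comm 1 n) he
    exact ⟨e', he'.symm.trans (hcomp' Y n e')⟩

theorem ext_eq_zero_of_isWeaklyRegular {C M : ModuleCat.{u} R} {rs : List R}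
    (hrs : IsWeaklyRegular M rs) (hC : ∀ r ∈ rs, ∀ c : C, r • c = 0) {j : ℕ}
    (hj : j < rs.length) (e : Ext C M j) : e = 0 := by
  induction rs generalizing M j with
  | nil => simp at hj
  | cons r rs ih =>
    obtain ⟨hr, hrs'⟩ := (isWeaklyRegular_cons_iff _ _ _).mp hrs
    have hrC := hC r List.mem_cons_self
    cases j with
    | zero =>
      obtain ⟨φ, rfl⟩ := Ext.addEquiv₀.symm.surjective e
      have : φ = 0 := by
        ext c
        refine hr.right_eq_zero_of_smul ?_
        rw [← map_smul, hrC, map_zero]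
      rw [this, map_zero]
    | succ j =>
      obtain ⟨δ, hδ, -⟩ := exists_ext_quotSMulTop_one hr
      obtain ⟨e', rfl⟩ := hδ C j e (ext_smul_eq_zero_of_smul_eq_zero hrC e)
      rw [ih (M := ModuleCat.of R (QuotSMulTop r M)) hrs'
        (fun s hs ↦ hC s (List.mem_cons_of_mem _ hs)) (by simpa using hj) e', Ext.zero_comp]

/-- The Rees isomorphism `Hom(C, M / rs M) ≃ Ext^|rs|(C, M)` for an `M`-regular sequence `rs`
killing `C`, realised as composition with a class that does not depend on `C`. -/
theorem exists_ext_comp_bijective_of_isWeaklyRegular {M N : ModuleCat.{u} R} {rs : List R}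
    (hrs : IsWeaklyRegular M rs)
    (f : N ≃ₗ[R] M ⧸ (Ideal.ofList rs • ⊤ : Submodule R M)) :
    ∃ c : Ext N M rs.length, ∀ C : ModuleCat.{u} R, (∀ r ∈ rs, ∀ c : C, r • c = 0) →
      Function.Bijective fun e : Ext C N 0 ↦ e.comp c (zero_add _) := by
  induction rs generalizing M with
  | nil =>
    let g : N ≅ M := (f.trans (Submodule.quotEquivOfEqBot _ (by simp))).toModuleIso
    refine ⟨Ext.mk₀ g.hom, fun C _ ↦ Function.bijective_iff_has_inverse.mpr
      ⟨fun e ↦ e.comp (Ext.mk₀ g.inv) (add_zero _), fun e ↦ ?_, fun e ↦ ?_⟩⟩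
    · change (e.comp (Ext.mk₀ g.hom) _).comp (Ext.mk₀ g.inv) _ = e
      rw [Ext.comp_assoc_of_third_deg_zero, Ext.mk₀_comp_mk₀, g.hom_inv_id, Ext.comp_mk₀_id]
    · change (e.comp (Ext.mk₀ g.inv) _).comp (Ext.mk₀ g.hom) _ = e
      rw [Ext.comp_assoc_of_third_deg_zero, Ext.mk₀_comp_mk₀, g.inv_hom_id, Ext.comp_mk₀_id]
  | cons r rs ih =>
    obtain ⟨hr, hrs'⟩ := (isWeaklyRegular_cons_iff _ _ _).mp hrs
    obtain ⟨c, hc⟩ := ih (M := ModuleCat.of R (QuotSMulTop r M)) hrs'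
      (f.trans (Submodule.quotOfListConsSMulTopEquivQuotSMulTopInner M r rs))
    obtain ⟨δ, hδ₁, hδ₃, -⟩ := exists_ext_quotSMulTop_one hr
    refine ⟨c.comp δ rfl, fun C hC ↦ ?_⟩
    have hcC := hc C fun s hs ↦ hC s (List.mem_cons_of_mem _ hs)
    have hδ : Function.Bijective fun e : Ext C (ModuleCat.of R (QuotSMulTop r M)) rs.length ↦
        e.comp δ (rfl : rs.length + 1 = _) := by
      refine ⟨(injective_iff_map_eq_zero (δ.postcomp C rfl)).mpr fun e he ↦ ?_,
        fun e ↦ hδ₁ C _ e (ext_smul_eq_zero_of_smul_eq_zero (hC r List.mem_cons_self) e)⟩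
      obtain ⟨e', g, rfl⟩ := hδ₃ C _ e he
      rw [ext_eq_zero_of_isWeaklyRegular hrs hC (by simp) e', Ext.zero_comp]
    exact (congrArg Function.Bijective
      (funext fun e ↦ Ext.comp_assoc e c δ (zero_add _) rfl (by simp))).mp (hδ.comp hcC)

variable [IsNoetherianRing R]

theorem ext_exists_notMem_smul_eq_zero {Q : Ideal R} [Q.IsPrime] {a : Ideal R}
    (ha : Q ∈ a.minimalPrimes) {Y : ModuleCat.{u} R} {i : ℕ}
    (hQ : ∀ e : Ext (ModuleCat.of R (R ⧸ Q)) Y i, ∃ s ∉ Q, s • e = 0)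
    (C : Type u) [AddCommGroup C] [Module R C] [Module.Finite R C]
    (hC : ∀ s ∈ a, ∀ c : C, s • c = 0) (e : Ext (ModuleCat.of R C) Y i) :
    ∃ s ∉ Q, s • e = 0 := by
  have key (M : Type u) [AddCommGroup M] [Module R M] (hfin : Module.Finite R M) :
      (∀ s ∈ a, ∀ c : M, s • c = 0) → ∀ e : Ext (ModuleCat.of R M) Y i, ∃ s ∉ Q, s • e = 0 := by
    induction hfin using IsNoetherianRing.induction_on_isQuotientEquivQuotientPrime R with
    | subsingleton N =>
      exact fun _ e ↦ ⟨1, Q.ne_top_iff_one.mp (Ideal.IsPrime.ne_top ‹_›),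
        ext_smul_eq_zero_of_smul_eq_zero (fun x : N ↦ Subsingleton.elim _ _) e⟩
    | quotient N p f =>
      intro hN e
      by_cases hpQ : p.1 ≤ Q
      · have hap : a ≤ p.1 := fun s hs ↦ by
          have := congrArg f (hN s hs (f.symm 1))
          rw [map_smul, f.apply_symm_apply, map_zero, Algebra.smul_def, mul_one] at this
          exact Ideal.Quotient.eq_zero_iff_mem.mp this
        obtain ⟨p, hp⟩ := p
        obtain rfl : p = Q := le_antisymm hpQ (ha.2 ⟨hp, hap⟩ hpQ)
        obtain ⟨s, hs, hse⟩ := hQ ((Ext.mk₀ f.toModuleIso.inv).comp e (zero_add i))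
        refine ⟨s, hs, ?_⟩
        rw [← Ext.mk₀_id_comp e, ← f.toModuleIso.hom_inv_id, ← Ext.mk₀_comp_mk₀_assoc,
          ← Ext.comp_smul, hse, Ext.comp_zero]
      · obtain ⟨s, hs, hsQ⟩ := SetLike.not_le_iff_exists.mp hpQ
        refine ⟨s, hsQ, ext_smul_eq_zero_of_smul_eq_zero (fun x : N ↦ f.injective ?_) e⟩
        obtain ⟨y, hy⟩ := Ideal.Quotient.mk_surjective (f x)
        rw [map_smul, map_zero, ← hy, Algebra.smul_def]
        exact Ideal.Quotient.eq_zero_iff_mem.mpr (p.1.mul_mem_right _ hs)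
    | exact N₁ N₂ N₃ f g hf hg hfg h₁ h₃ =>
      intro hN e
      have hS := ModuleCat.shortComplex_shortExact
        (ModuleCat.shortComplexOfCompEqZero f g hfg.linearMap_comp_eq_zero) hfg hf hg
      obtain ⟨s, hs, hse⟩ := h₁ (fun s hs c ↦ hf (by rw [map_smul, hN s hs, map_zero]))
        ((Ext.mk₀ (ModuleCat.ofHom f)).comp e (zero_add i))
      rw [← Ext.comp_smul] at hse
      obtain ⟨e', he'⟩ := Ext.contravariant_sequence_exact₂ hS Y (s • e) hse
      obtain ⟨t, ht, hte⟩ := h₃ (fun s hs c ↦ by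
        obtain ⟨c, rfl⟩ := hg c
        rw [← map_smul, hN s hs, map_zero]) e'
      refine ⟨t * s, fun h ↦ (‹Q.IsPrime›.mem_or_mem h).elim ht hs, ?_⟩
      rw [mul_smul, ← he', ← Ext.comp_smul, hte, Ext.comp_zero]
  exact key C ‹_› hC e

theorem ext_exists_notMem_smul_eq_zero_of_minimalPrimes_sup_span {P Q : Ideal R} [P.IsPrime]
    [Q.IsPrime] {x : R} (hxP : x ∉ P) (hQ : Q ∈ (P ⊔ Ideal.span {x}).minimalPrimes)
    {Y : ModuleCat.{u} R} [Module.Finite R Y] {i : ℕ}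
    (h : ∀ e : Ext (ModuleCat.of R (R ⧸ Q)) Y (i + 1), ∃ s ∉ Q, s • e = 0)
    (e : Ext (ModuleCat.of R (R ⧸ P)) Y i) : ∃ s ∉ P, s • e = 0 := by
  have hPQ : P ≤ Q := le_sup_left.trans hQ.1.2
  have hxQ : x ∈ Q := hQ.1.2 (le_sup_right (a := P) (Ideal.mem_span_singleton_self x))
  have hreg : IsSMulRegular (R ⧸ P) x := IsSMulRegular.of_right_eq_zero_of_smul fun y hy ↦ by
    obtain ⟨y, rfl⟩ := Ideal.Quotient.mk_surjective y
    exact Ideal.Quotient.eq_zero_iff_mem.mpr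
      ((‹P.IsPrime›.mem_or_mem (Ideal.Quotient.eq_zero_iff_mem.mp hy)).resolve_left hxP)
  obtain ⟨δ, -, -, hδ⟩ := exists_ext_quotSMulTop_one (M := ModuleCat.of R (R ⧸ P)) hreg
  have hC : ∀ s ∈ P ⊔ Ideal.span {x}, ∀ c : QuotSMulTop x (R ⧸ P), s • c = 0 := by
    suffices P ⊔ Ideal.span {x} ≤ Module.annihilator R (QuotSMulTop x (R ⧸ P)) from
      fun s hs ↦ Module.mem_annihilator.mp (this hs)
    refine sup_le (fun s hs ↦ ?_) ?_
    · refine Module.mem_annihilator.mpr fun c ↦ ?_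
      obtain ⟨c, rfl⟩ := Submodule.Quotient.mk_surjective _ c
      obtain ⟨c, rfl⟩ := Ideal.Quotient.mk_surjective c
      rw [← Submodule.Quotient.mk_smul]
      have : s • Ideal.Quotient.mk P c = 0 :=
        Ideal.Quotient.eq_zero_iff_mem.mpr (P.mul_mem_right _ hs)
      rw [this, Submodule.Quotient.mk_zero]
    · rw [Ideal.span_singleton_le_iff_mem]
      refine Module.mem_annihilator.mpr fun c ↦ ?_
      obtain ⟨c, rfl⟩ := Submodule.Quotient.mk_surjective _ c
      rw [← Submodule.Quotient.mk_smul, Submodule.Quotient.mk_eq_zero]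
      exact Submodule.smul_mem_pointwise_smul _ _ _ Submodule.mem_top
  obtain ⟨s, hs, hsE⟩ := exists_notMem_smul_eq_zero_of_smul_mem
    (E := Ext (ModuleCat.of R (R ⧸ P)) Y i) Q hxQ fun e ↦ by
    obtain ⟨s, hs, hse⟩ := ext_exists_notMem_smul_eq_zero hQ h (QuotSMulTop x (R ⧸ P)) hC
      (δ.comp e (add_comm 1 i))
    rw [← Ext.comp_smul] at hse
    exact ⟨s, hs, hδ Y i (s • e) hse⟩
  exact ⟨s, fun h ↦ hs (hPQ h), hsE e⟩

theorem exists_ext_exists_notMem_smul_eq_zero_of_subsingleton [IsLocalRing R]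
    (Y : ModuleCat.{u} R) [Module.Finite R Y] (P : Ideal R) [hP : P.IsPrime] :
    ∃ d : ℕ, ∀ i : ℕ,
      Subsingleton (Ext (ModuleCat.of R (R ⧸ IsLocalRing.maximalIdeal R)) Y (i + d)) →
        ∀ e : Ext (ModuleCat.of R (R ⧸ P)) Y i, ∃ s ∉ P, s • e = 0 := by
  revert hP
  induction P using WellFoundedGT.induction with
  | ind P ih =>
    intro hP
    by_cases hPm : P = IsLocalRing.maximalIdeal R
    · subst hPm
      exact ⟨0, fun i h e ↦ ⟨1, (Ideal.ne_top_iff_one _).mp hP.ne_top, h.elim _ _⟩⟩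
    · have hle := IsLocalRing.le_maximalIdeal hP.ne_top
      obtain ⟨x, hxm, hxP⟩ := SetLike.exists_of_lt (lt_of_le_of_ne hle hPm)
      obtain ⟨Q, hQ, -⟩ := Ideal.exists_minimalPrimes_le (J := IsLocalRing.maximalIdeal R)
        (sup_le hle ((Ideal.span_singleton_le_iff_mem _).mpr hxm))
      have hQp : Q.IsPrime := hQ.1.1
      have hxQ : x ∈ Q := hQ.1.2 (le_sup_right (a := P) (Ideal.mem_span_singleton_self x))
      have hlt : P < Q := lt_of_le_of_ne (le_sup_left.trans hQ.1.2) fun h ↦ hxP (by rwa [h])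
      obtain ⟨d, hd⟩ := ih Q hlt
      refine ⟨d + 1, fun i h ↦
        ext_exists_notMem_smul_eq_zero_of_minimalPrimes_sup_span hxP hQ (hd (i + 1) ?_)⟩
      rwa [add_assoc, add_comm 1 d]

theorem subsingleton_ext_quotient_maximalIdeal [IsLocalRing R] {rs : List R}
    (hrs : IsRegular R rs) (hspan : Ideal.ofList rs = IsLocalRing.maximalIdeal R) {j : ℕ}
    (hj : j ≠ rs.length) :
    Subsingleton (Ext (ModuleCat.of R (R ⧸ IsLocalRing.maximalIdeal R)) (ModuleCat.of R R) j) := by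
  have hmem : ∀ r ∈ rs, r ∈ IsLocalRing.maximalIdeal R :=
    fun r hr ↦ hspan ▸ Ideal.subset_span hr
  rcases lt_or_gt_of_ne hj with hj | hj
  · refine subsingleton_of_forall_eq 0 fun e ↦
      ext_eq_zero_of_isWeaklyRegular hrs.toIsWeaklyRegular (fun r hr c ↦ ?_) hj e
    obtain ⟨c, rfl⟩ := Ideal.Quotient.mk_surjective c
    exact Ideal.Quotient.eq_zero_iff_mem.mpr (Ideal.mul_mem_right _ _ (hmem r hr))
  · have hpd := ModuleCat.projectiveDimension_quotient_eq_add_length_of_isWeaklyRegular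
      (ModuleCat.of R R) rs hrs.toIsWeaklyRegular hmem
    rw [ModuleCat.projectiveDimension_eq_zero_of_projective (ModuleCat.of R R), zero_add] at hpd
    let e : (R ⧸ IsLocalRing.maximalIdeal R) ≃ₗ[R] R ⧸ (Ideal.ofList rs • ⊤ : Submodule R R) :=
      Submodule.quotEquivOfEq _ _ (by rw [hspan, smul_eq_mul, Ideal.mul_top])
    have := (projectiveDimension_le_iff _ _).mp
      ((projectiveDimension_eq_of_iso e.toModuleIso).trans hpd).le
    exact HasProjectiveDimensionLT.subsingleton _ _ _ hj _

/-- In a regular local ring, a module killed by a complete intersection ideal and containing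
`R ⧸ P`, with `P` minimal over that ideal, has a homomorphism to the complete intersection ring
which does not vanish on `R ⧸ P`. -/
theorem exists_linearMap_comp_ne_zero [IsLocalRing R] {rs : List R}
    (hrs : IsRegular R rs) (hspan : Ideal.ofList rs = IsLocalRing.maximalIdeal R)
    {gs : List R} (hgs : IsWeaklyRegular R gs) {P : Ideal R} [P.IsPrime]
    (hP : P ∈ (Ideal.ofList gs).minimalPrimes)
    {M : Type u} [AddCommGroup M] [Module R M] [Module.Finite R M]
    (hM : ∀ s ∈ Ideal.ofList gs, ∀ m : M, s • m = 0)
    (ι : (R ⧸ P) →ₗ[R] M) (hι : Function.Injective ι) :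
    ∃ φ : M →ₗ[R] R ⧸ Ideal.ofList gs, φ ∘ₗ ι ≠ 0 := by
  have hgM : ∀ r ∈ gs, ∀ m : M, r • m = 0 := fun r hr ↦ hM r (Ideal.subset_span hr)
  have hgP : ∀ r ∈ gs, ∀ m : R ⧸ P, r • m = 0 :=
    fun r hr m ↦ hι (by rw [map_smul, hgM r hr, map_zero])
  have hass : P ∈ associatedPrimes R (R ⧸ Ideal.ofList gs) :=
    Module.associatedPrimes.minimalPrimes_annihilator_subset_associatedPrimes R _
      (by rwa [Ideal.annihilator_quotient])
  obtain ⟨-, φ₀, hφ₀⟩ := (isAssociatedPrime_iff_exists_injective_linearMap _ _).mp hass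
  obtain ⟨c, hc⟩ := exists_ext_comp_bijective_of_isWeaklyRegular
    (M := ModuleCat.of R R) (N := ModuleCat.of R (R ⧸ Ideal.ofList gs)) hgs
    (Submodule.quotEquivOfEq _ _ (by rw [smul_eq_mul, Ideal.mul_top]))
  have hcP := hc (ModuleCat.of R (R ⧸ P)) hgP
  have hcM := hc (ModuleCat.of R M) hgM
  have hne : ∀ s ∉ P, s • Ext.mk₀ (ModuleCat.ofHom φ₀) ≠ 0 := fun s hs h ↦ hs <| by
    rw [← Ext.mk₀_smul, Ext.mk₀_eq_zero_iff] at h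
    have h1 : s • φ₀ 1 = 0 := congrArg (fun φ ↦ φ.hom 1) h
    rw [← map_smul, ← map_zero φ₀] at h1
    have h2 := hφ₀ h1
    rw [Algebra.smul_def, mul_one] at h2
    exact Ideal.Quotient.eq_zero_iff_mem.mp h2
  have hinj {x : Ext (ModuleCat.of R (R ⧸ P)) (ModuleCat.of R (R ⧸ Ideal.ofList gs)) 0}
      (hx : x.comp c (zero_add _) = 0) : x = 0 :=
    hcP.injective (hx.trans (Ext.zero_comp ..).symm)
  obtain ⟨d, hd⟩ := exists_ext_exists_notMem_smul_eq_zero_of_subsingleton (ModuleCat.of R R) P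
  have hlen : gs.length + d = rs.length := by
    by_contra hlen
    obtain ⟨s, hs, hse⟩ := hd _ (subsingleton_ext_quotient_maximalIdeal hrs hspan hlen)
      ((Ext.mk₀ (ModuleCat.ofHom φ₀)).comp c (zero_add _))
    rw [← Ext.smul_comp] at hse
    exact hne s hs (hinj hse)
  have hV := hd (gs.length + 1)
    (subsingleton_ext_quotient_maximalIdeal hrs hspan (by omega))
  have hS := ModuleCat.shortComplex_shortExact
    (ModuleCat.shortComplexOfCompEqZero ι (LinearMap.range ι).mkQ
      (LinearMap.range_mkQ_comp ι)) (LinearMap.exact_map_mkQ_range ι) hι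
      (Submodule.mkQ_surjective _)
  obtain ⟨s, hs, hse⟩ := ext_exists_notMem_smul_eq_zero hP hV (M ⧸ LinearMap.range ι)
    (fun s hs m ↦ by
      obtain ⟨m, rfl⟩ := Submodule.mkQ_surjective _ m
      rw [← map_smul, hM s hs, map_zero])
    (hS.extClass.comp ((Ext.mk₀ (ModuleCat.ofHom φ₀)).comp c (zero_add _)) (add_comm 1 _))
  rw [← Ext.comp_smul] at hse
  obtain ⟨e, he⟩ := Ext.contravariant_sequence_exact₁ hS _ _ (add_comm 1 _) hse
  obtain ⟨x, rfl⟩ := hcM.surjective e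
  obtain ⟨φ, rfl⟩ := Ext.addEquiv₀.symm.surjective x
  refine ⟨φ.hom, fun h ↦ hne s hs (hinj ?_)⟩
  rw [Ext.smul_comp]
  refine he.symm.trans ((Ext.mk₀_comp_mk₀_assoc (ModuleCat.ofHom ι) φ c).trans ?_)
  have hφ : ModuleCat.ofHom ι ≫ φ = 0 := ModuleCat.hom_ext h
  rw [hφ, Ext.mk₀_zero, Ext.zero_comp]

end LocalVanishing

theorem length_le_height_of_isWeaklyRegular {R : Type*} [CommRing R] {rs : List R}
    (hrs : IsWeaklyRegular R rs) (Q : Ideal R) [Q.IsPrime] (hQ : Ideal.ofList rs ≤ Q) :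
    (rs.length : ℕ∞) ≤ Q.height := by
  induction rs using List.reverseRecOn generalizing Q with
  | nil => simp
  | append_singleton rs a ih =>
    rw [isWeaklyRegular_append_iff, isWeaklyRegular_singleton_iff] at hrs
    rw [Ideal.ofList_append, Ideal.ofList_singleton] at hQ
    obtain ⟨Q', hQ', hle⟩ := Ideal.exists_minimalPrimes_le (le_sup_left.trans hQ)
    have := hQ'.1.1
    have ha : a ∉ Q' := hrs.2.notMem_of_mem_minimalPrimes (by
      rw [smul_eq_mul, Ideal.mul_top, Ideal.annihilator_quotient]; exact hQ')
    have hlt : Q' < Q := lt_of_le_of_ne hle fun h ↦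
      ha (h ▸ hQ (le_sup_right (a := Ideal.ofList rs) (Ideal.mem_span_singleton_self a)))
    calc ((rs ++ [a]).length : ℕ∞) = rs.length + 1 := by simp
      _ ≤ Q'.height + 1 := by gcongr; exact ih hrs.1 Q' hQ'.1.2
      _ ≤ Q.height := Ideal.height_add_one_le_of_lt_of_isPrime hlt

theorem idealHeight_eq_height {R : Type*} [CommRing R] (P : Ideal R) [hP : P.IsPrime] :
    idealHeight P = P.height :=
  le_antisymm (iInf₂_le_of_le ⟨P, hP⟩ le_rfl (PrimeSpectrum.height_eq_orderHeight ⟨P, hP⟩).ge)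
    (le_iInf₂ fun Q hQ ↦ (Ideal.height_mono hQ).trans_eq (PrimeSpectrum.height_eq_orderHeight Q))

/-- **Linkage theorem.** In a regular Noetherian local ring, if `I` is a complete
intersection ideal generated by a regular sequence of length `p`, and `J ⊇ I`
is a proper ideal of pure codimension `p` (every associated prime of `R ⧸ J`
has height `p`), then with `K = I : J` one has `I : K = J`. -/
theorem linkage_double_colon
    {R : Type*} [CommRing R] [IsNoetherianRing R] [IsLocalRing R]
    (hreg : ∃ rs : List R, RingTheory.Sequence.IsRegular R rs ∧
      Ideal.span {x | x ∈ rs} = IsLocalRing.maximalIdeal R)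
    (p : ℕ) (hp : 1 ≤ p) (f : Fin p → R)
    (hf : RingTheory.Sequence.IsRegular R (List.ofFn f))
    (I : Ideal R) (hI : I = Ideal.span (Set.range f))
    (J : Ideal R) (hJne : J ≠ ⊤) (hIJ : I ≤ J)
    (hpure : ∀ P ∈ associatedPrimes R (R ⧸ J), idealHeight P = p)
    (K : Ideal R) (hK : K = Submodule.colon I J) :
    Submodule.colon I K = J := by
  subst hK
  refine le_antisymm ?_ fun r hr ↦ Submodule.mem_colon.mpr fun s hs ↦ ?_
  swap
  · rw [smul_eq_mul, mul_comm]
    exact Submodule.mem_colon.mp hs r hr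
  obtain ⟨rs, hrs, hspan⟩ := hreg
  have hIl : I = Ideal.ofList (List.ofFn f) := by
    rw [hI]
    exact congrArg Ideal.span (Set.ext fun x ↦ by simp [List.mem_ofFn])
  set L := Submodule.colon I (Submodule.colon I (J : Set R) : Set R)
  by_contra hle
  obtain ⟨r, hrL, hrJ⟩ := SetLike.not_le_iff_exists.mp hle
  let N : Submodule R (R ⧸ J) := Submodule.map J.mkQ L
  have : Nontrivial N := ⟨⟨⟨J.mkQ r, r, hrL, rfl⟩, 0, fun h ↦
    hrJ (Ideal.Quotient.eq_zero_iff_mem.mp (congrArg Subtype.val h))⟩⟩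
  obtain ⟨P, hPN⟩ := associatedPrimes.nonempty R N
  obtain ⟨hP, ι, hι⟩ := (isAssociatedPrime_iff_exists_injective_linearMap _ _).mp hPN
  have hι' : Function.Injective (N.subtype ∘ₗ ι) := N.injective_subtype.comp hι
  have hPh : P.height = p := by
    rw [← idealHeight_eq_height]
    exact hpure P ((isAssociatedPrime_iff_exists_injective_linearMap _ _).mpr ⟨hP, _, hι'⟩)
  have hIJ' : ∀ s ∈ I, ∀ m : R ⧸ J, s • m = 0 := fun s hs m ↦ by
    obtain ⟨m, rfl⟩ := Ideal.Quotient.mk_surjective m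
    exact Ideal.Quotient.eq_zero_iff_mem.mpr (J.mul_mem_right _ (hIJ hs))
  have hIP : I ≤ P := fun s hs ↦ by
    have := hIJ' s hs ((N.subtype ∘ₗ ι) 1)
    rw [← map_smul] at this
    have := hι' (this.trans (map_zero _).symm)
    rw [Algebra.smul_def, mul_one] at this
    exact Ideal.Quotient.eq_zero_iff_mem.mp this
  have hmin : P ∈ I.minimalPrimes := by
    have hfin : P.FiniteHeight := inferInstance
    refine Ideal.mem_minimalPrimes_of_height_le hIP ?_
    rw [hPh, Ideal.height_eq_inf_minimalPrimes]
    refine le_iInf₂ fun Q hQ ↦ ?_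
    have := hQ.1.1
    simpa using length_le_height_of_isWeaklyRegular hf.toIsWeaklyRegular Q (hIl ▸ hQ.1.2)
  subst hIl
  obtain ⟨φ, hφ⟩ := exists_linearMap_comp_ne_zero hrs hspan hf.toIsWeaklyRegular hmin hIJ' _ hι'
  obtain ⟨k, hk⟩ := Ideal.Quotient.mk_surjective (φ 1)
  have hφk (x : R) : φ (Ideal.Quotient.mk J x) = Ideal.Quotient.mk _ (x * k) := by
    calc φ (Ideal.Quotient.mk J x) = φ (x • 1) := by
          rw [Algebra.smul_def, mul_one, Ideal.Quotient.algebraMap_eq]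
      _ = Ideal.Quotient.mk _ (x * k) := by
          rw [map_smul, ← hk, Algebra.smul_def, Ideal.Quotient.algebraMap_eq, map_mul]
  have hkK : k ∈ Submodule.colon (Ideal.ofList (List.ofFn f)) (J : Set R) :=
    Submodule.mem_colon.mpr fun j hj ↦ by
      rw [smul_eq_mul, mul_comm, ← Ideal.Quotient.eq_zero_iff_mem, ← hφk,
        Ideal.Quotient.eq_zero_iff_mem.mpr hj, map_zero]
  refine hφ (LinearMap.ext fun y ↦ ?_)
  obtain ⟨x, hxL, hx⟩ := (ι y).2
  calc φ (ι y) = φ (Ideal.Quotient.mk J x) := congrArg φ hx.symm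
    _ = 0 := by
      rw [hφk, Ideal.Quotient.eq_zero_iff_mem]
      exact Submodule.mem_colon.mp hxL k hkK
end

section
/- Let R be a commutative Noetherian local ring, let f₁, …, f_p and g₁, …, g_p be two regular sequences in R, and let A be a p × p matrix over R such that f_i = Σ_j A_{ij} g_j for every i (i.e. f = A·g, so that (f₁,…,f_p) ⊆ (g₁,…,g_p)). Then for every h ∈ R: h belongs to the ideal J = (g₁, …, g_p) if and only if (det A)·h belongs to the ideal I = (f₁, …, f_p). Equivalently, J = I : (det A). -/
/-- Contraction of an `R`-valued function `w` of lists of vectors with a function `φ`: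
`w ↦ ∑ i, (-1) ^ i * φ cᵢ * w (c₀, …, ĉᵢ, …)`. -/
def listContraction {R V : Type*} [CommRing R] (φ : V → R) :
    List V → (List V → R) →ₗ[R] R
  | [] => 0
  | c :: cs => φ c • LinearMap.proj cs -
      listContraction φ cs ∘ₗ LinearMap.funLeft R R (fun l => c :: l)

section listContraction

variable {R V : Type*} [CommRing R] (φ : V → R)

@[simp]
theorem listContraction_nil (w : List V → R) : listContraction φ [] w = 0 := rfl

theorem listContraction_cons (c : V) (cs : List V) (w : List V → R) :
    listContraction φ (c :: cs) w =
      φ c * w cs - listContraction φ cs (fun l => w (c :: l)) := rfl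

theorem listContraction_listContraction (cs : List V) (w : List V → R) :
    listContraction φ cs (fun l => listContraction φ l w) = 0 := by
  induction cs generalizing w with
  | nil => rfl
  | cons c cs ih =>
    have key : (fun l => listContraction φ (c :: l) w) =
        φ c • w - fun l => listContraction φ l (fun l => w (c :: l)) := by
      funext l
      simp [listContraction_cons]
    rw [listContraction_cons, key, map_sub, map_smul, ih, smul_eq_mul, sub_zero, sub_self]

theorem listContraction_mem {I : Ideal R} {n : ℕ} {w : List V → R}
    (hw : ∀ l : List V, l.length = n → w l ∈ I) {cs : List V} (hcs : cs.length = n + 1) :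
    listContraction φ cs w ∈ I := by
  induction cs generalizing n w with
  | nil => simp
  | cons c cs ih =>
    simp only [List.length_cons, Nat.add_right_cancel_iff] at hcs
    rw [listContraction_cons]
    refine I.sub_mem (I.mul_mem_left _ (hw cs hcs)) ?_
    cases n with
    | zero => simp [List.length_eq_zero_iff.mp hcs]
    | succ n => exact ih (fun l hl => hw _ (by simp [hl])) hcs

theorem listContraction_ofFn {n : ℕ} (c : Fin (n + 1) → V) (w : List V → R) :
    listContraction φ (List.ofFn c) w =
      ∑ i : Fin (n + 1), (-1) ^ (i : ℕ) * φ (c i) * w (List.ofFn fun j => c (i.succAbove j)) := by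
  induction n generalizing w with
  | zero => simp [listContraction_cons]
  | succ n ih =>
    rw [List.ofFn_succ, listContraction_cons, ih, Fin.sum_univ_succ (n := n + 1),
      sub_eq_add_neg, ← Finset.sum_neg_distrib]
    congr 1
    · simp
    · refine Finset.sum_congr rfl fun i _ => ?_
      rw [List.ofFn_succ (n := n)]
      simp [pow_succ]

open RingTheory.Sequence in
/-- If `φ` maps `as` to a sequence regular modulo `rs` and the contraction of `E` vanishes modulo
`rs`, then `h • E` is a contraction modulo `rs` as soon as `h * E as` vanishes modulo the longer
sequence. -/
theorem exists_mul_sub_listContraction_mem (h : R) (as : List V) (rs : List R)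
    (E : List V → R) (hreg : IsWeaklyRegular R (rs ++ as.map φ))
    (hE : ∀ cs : List V, cs.length = as.length + 1 → listContraction φ cs E ∈ Ideal.ofList rs)
    (hh : E as * h ∈ Ideal.ofList (rs ++ as.map φ)) :
    ∃ u : List V → R, ∀ cs : List V, cs.length = as.length →
      h * E cs - listContraction φ cs u ∈ Ideal.ofList rs := by
  induction as generalizing rs E with
  | nil =>
    refine ⟨0, fun cs hcs => ?_⟩
    rw [List.length_eq_zero_iff.mp hcs]
    simpa [mul_comm] using hh
  | cons a as ih =>
    have happ : rs ++ (a :: as).map φ = (rs ++ [φ a]) ++ as.map φ := by simp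
    have cancel (x : R) (hx : φ a * x ∈ Ideal.ofList rs) : x ∈ Ideal.ofList rs := by
      have hr := hreg.regular_mod_prev rs.length (by simp)
      simp only [List.map_cons, List.getElem_append_right le_rfl, Nat.sub_self,
        List.getElem_cons_zero] at hr
      simpa using mem_of_isSMulRegular_quotient_of_smul_mem hr (x := x) (by simpa using hx)
    have hE' (cs : List V) (hcs : cs.length = as.length + 1) :
        φ a * E cs - listContraction φ cs (fun l => E (a :: l)) ∈ Ideal.ofList rs := by
      simpa [listContraction_cons] using hE (a :: cs) (by simp [hcs])
    obtain ⟨w, hw⟩ := ih (rs ++ [φ a]) (fun l => E (a :: l)) (happ ▸ hreg)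
      (fun cs hcs => by
        rw [Ideal.ofList_append, Ideal.ofList_singleton]
        have := Ideal.mul_mem_right (E cs) _ (Ideal.mem_span_singleton_self (φ a))
        simpa using Ideal.sub_mem _ (Ideal.mem_sup_right (S := Ideal.ofList rs) this)
          (Ideal.mem_sup_left (hE' cs hcs)))
      (happ ▸ hh)
    have hu (cs : List V) : ∃ y, cs.length = as.length →
        h * E (a :: cs) - listContraction φ cs w - φ a * y ∈ Ideal.ofList rs := by
      by_cases hcs : cs.length = as.length
      · have := hw cs hcs
        rw [Ideal.ofList_append, Ideal.ofList_singleton, Submodule.mem_sup] at this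
        obtain ⟨x, hx, z, hz, hxz⟩ := this
        obtain ⟨y, rfl⟩ := Ideal.mem_span_singleton'.mp hz
        exact ⟨y, fun _ => by rw [← hxz]; convert hx using 1; ring⟩
      · exact ⟨0, fun h => absurd h hcs⟩
    choose u hu using hu
    refine ⟨u, fun cs hcs => cancel _ ?_⟩
    have hd : listContraction φ cs
          (h • (fun l => E (a :: l)) - (fun l => listContraction φ l w) - φ a • u) ∈
        Ideal.ofList rs := listContraction_mem φ hu hcs
    rw [map_sub, map_sub, map_smul, map_smul, listContraction_listContraction] at hd
    convert Ideal.add_mem _ hd (Ideal.mul_mem_left _ h (hE' cs hcs)) using 1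
    simp only [smul_eq_mul]
    ring

end listContraction

theorem sum_dotProduct_mul_det_succAbove {R : Type*} [CommRing R] {p : ℕ} (g : Fin p → R)
    (c : Fin (p + 1) → Fin p → R) :
    ∑ i : Fin (p + 1), (-1) ^ (i : ℕ) * (c i ⬝ᵥ g) *
      Matrix.det (Matrix.of fun j => c (i.succAbove j)) = 0 := by
  let M : Matrix (Fin (p + 1)) (Fin (p + 1)) R :=
    Matrix.of fun i => Fin.cons (c i ⬝ᵥ g) (c i)
  let v : Fin (p + 1) → R := Fin.cons (-1) g
  have hMv : M.mulVec v = 0 := by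
    funext i
    simp [M, v, Matrix.mulVec, dotProduct, Fin.sum_univ_succ]
  have hdet : M.det = 0 := by
    have := congrArg M.adjugate.mulVec hMv
    rw [Matrix.mulVec_mulVec, Matrix.adjugate_mul, Matrix.smul_mulVec, Matrix.one_mulVec,
      Matrix.mulVec_zero] at this
    simpa [v] using congrFun this 0
  rw [← hdet, Matrix.det_succ_column_zero]
  rfl

theorem det_mul_mem_span_range {R : Type*} [CommRing R] {p : ℕ} {f g : Fin p → R}
    {A : Matrix (Fin p) (Fin p) R} (hA : f = A.mulVec g) {h : R}
    (hh : h ∈ Ideal.span (Set.range g)) : A.det * h ∈ Ideal.span (Set.range f) := by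
  induction hh using Submodule.span_induction with
  | mem x hx =>
    obtain ⟨j, rfl⟩ := hx
    have : A.det * g j = (A.adjugate.mulVec f) j := by
      rw [hA, Matrix.mulVec_mulVec, Matrix.adjugate_mul, Matrix.smul_mulVec,
        Matrix.one_mulVec, Pi.smul_apply, smul_eq_mul]
    rw [this]
    change ∑ i, A.adjugate j i * f i ∈ _
    exact Ideal.sum_mem _ fun i _ =>
      Ideal.mul_mem_left _ _ (Ideal.subset_span (Set.mem_range_self i))
  | zero => simp
  | add x y _ _ hx hy => rw [mul_add]; exact Ideal.add_mem _ hx hy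
  | smul a x _ hx => rw [smul_eq_mul, mul_left_comm]; exact Ideal.mul_mem_left _ _ hx

theorem mem_span_range_of_det_mul_mem {R : Type*} [CommRing R] {p : ℕ} {f g : Fin p → R}
    (hf : RingTheory.Sequence.IsWeaklyRegular R (List.ofFn f))
    {A : Matrix (Fin p) (Fin p) R} (hA : f = A.mulVec g) {h : R}
    (hh : A.det * h ∈ Ideal.span (Set.range f)) : h ∈ Ideal.span (Set.range g) := by
  let φ : (Fin p → R) → R := fun v => v ⬝ᵥ g
  let E : List (Fin p → R) → R := fun l => Matrix.det (Matrix.of fun i : Fin p => l.getD i 0)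
  have hEofFn (c : Fin p → Fin p → R) : E (List.ofFn c) = Matrix.det (Matrix.of c) := by
    simp [E]
  have hmap : (List.ofFn A.row).map φ = List.ofFn f := by
    rw [List.map_ofFn, hA]
    rfl
  obtain ⟨u, hu⟩ := exists_mul_sub_listContraction_mem φ h (List.ofFn A.row) [] E
    (by simpa only [hmap, List.nil_append] using hf)
    (fun cs hcs => by
      obtain ⟨c, rfl⟩ : ∃ c : Fin (p + 1) → Fin p → R, cs = List.ofFn c := by
        rw [List.length_ofFn] at hcs
        exact ⟨fun i => cs.get (i.cast hcs.symm), by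
          apply List.ext_getElem <;> simp [hcs, -List.ofFn_succ]⟩
      rw [listContraction_ofFn]
      simp only [hEofFn]
      rw [sum_dotProduct_mul_det_succAbove]
      exact Ideal.zero_mem _)
    (by
      rw [hmap, List.nil_append, hEofFn]
      change A.det * h ∈ _
      simpa [Ideal.ofList, List.mem_ofFn', Set.range] using hh)
  have := hu (List.ofFn (1 : Matrix (Fin p) (Fin p) R).row) (by simp)
  rw [hEofFn, Ideal.ofList_nil, Ideal.mem_bot, sub_eq_zero] at this
  have h1 : (Matrix.of (1 : Matrix (Fin p) (Fin p) R).row) = 1 := rfl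
  rw [h1, Matrix.det_one, mul_one] at this
  rw [this]
  cases p with
  | zero => simp
  | succ n =>
    rw [listContraction_ofFn]
    refine Ideal.sum_mem _ fun i _ => Ideal.mul_mem_right _ _ (Ideal.mul_mem_left _ _ ?_)
    have : φ ((1 : Matrix (Fin (n + 1)) (Fin (n + 1)) R).row i) = g i :=
      congrFun (Matrix.one_mulVec g) i
    rw [this]
    exact Ideal.subset_span (Set.mem_range_self i)

/-- **Transformation law / Wiebe's theorem.** Let `f` and `g` be regular
sequences of length `p` in a Noetherian local ring, and `A` a `p × p` matrix
with `f = A · g`. Then for every `h`, `h ∈ (g₁, …, g_p)` if and only if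
`det A · h ∈ (f₁, …, f_p)`. -/
theorem mem_span_iff_det_smul_mem_span
    {R : Type*} [CommRing R] [IsNoetherianRing R] [IsLocalRing R]
    (p : ℕ) (f g : Fin p → R)
    (hf : RingTheory.Sequence.IsRegular R (List.ofFn f))
    (hg : RingTheory.Sequence.IsRegular R (List.ofFn g))
    (A : Matrix (Fin p) (Fin p) R)
    (hA : ∀ i, f i = ∑ j, A i j * g j)
    (h : R) :
    h ∈ Ideal.span (Set.range g) ↔ A.det * h ∈ Ideal.span (Set.range f) := by
  have hA' : f = A.mulVec g := funext hA
  exact ⟨det_mul_mem_span_range hA', mem_span_range_of_det_mul_mem hf.toIsWeaklyRegular hA'⟩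
end

section
/- Let R be a commutative Noetherian regular local ring, let f₁, f₂ ∈ R be a regular sequence and I = (f₁, f₂). Let J be a proper ideal of R of height 2 with I ⊆ J, and suppose R⧸J admits a free resolution of length 2: R-linear maps φ₂ : R^r → R^m and φ₁ : R^m → R such that φ₂ is injective, the kernel of φ₁ equals the range of φ₂, and the range of φ₁ equals J. Suppose a₁ : R² → R^m and a₂ : R → R^r are R-linear maps satisfying φ₁(a₁(u, v)) = f₁·u + f₂·v for all u, v ∈ R, and φ₂(a₂(t)) = a₁(−f₂·t, f₁·t) for all t ∈ R (so a₁, a₂ extend the natural surjection R⧸I → R⧸J from the Koszul complex of (f₁, f₂) to the given resolution). Let L be the ideal generated by the r coordinates of a₂(1). Then I : J = I + L. -/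
/-- A linear map out of a finite free module lifts through any linear map whose range contains
its range. -/
theorem LinearMap.exists_comp_eq_of_range_le {R ι N M : Type*} [CommRing R] [Finite ι]
    [AddCommGroup N] [Module R N] [AddCommGroup M] [Module R M]
    (G : N →ₗ[R] M) (F : (ι → R) →ₗ[R] M) (h : LinearMap.range F ≤ LinearMap.range G) :
    ∃ H : (ι → R) →ₗ[R] N, ∀ z, G (H z) = F z := by
  obtain ⟨H, hH⟩ := Module.projective_lifting_property G.rangeRestrict
    (F.codRestrict (LinearMap.range G) fun z => h ⟨z, rfl⟩) G.surjective_rangeRestrict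
  exact ⟨H, fun z => congrArg Subtype.val (LinearMap.congr_fun hH z)⟩

open scoped Pointwise in
/-- Exactness of the Koszul complex of a weakly regular sequence of length two in the middle. -/
theorem RingTheory.Sequence.IsWeaklyRegular.exists_eq_neg_mul_and_eq_mul {R : Type*} [CommRing R]
    {f₁ f₂ : R} (hf : RingTheory.Sequence.IsWeaklyRegular R [f₁, f₂]) {p q : R}
    (h : f₁ * p + f₂ * q = 0) : ∃ t : R, p = -(f₂ * t) ∧ q = f₁ * t := by
  simp only [RingTheory.Sequence.isWeaklyRegular_cons_iff] at hf
  obtain ⟨h₁, h₂, -⟩ := hf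
  have hq : q ∈ f₁ • (⊤ : Submodule R R) :=
    mem_of_isSMulRegular_quotient_of_smul_mem h₂
      ((Submodule.mem_smul_pointwise_iff_exists _ _ _).2 ⟨-p, trivial, by
        simp only [smul_eq_mul]; linear_combination -h⟩)
  obtain ⟨t, -, rfl⟩ := (Submodule.mem_smul_pointwise_iff_exists _ _ _).1 hq
  refine ⟨t, h₁ ?_, rfl⟩
  simp only [smul_eq_mul] at h ⊢
  linear_combination h

/-- **Lemma 2.3 of the paper, codimension 2 case.** Let `J` be a Cohen-Macaulay
ideal of codimension `2` in a regular Noetherian local ring, with a free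
resolution `0 → R^r → R^m → R → R⧸J → 0`, let `I = (f₁, f₂) ⊆ J` be a
complete intersection, and let `a₁, a₂` be a comparison morphism from the
Koszul complex of `(f₁, f₂)` to the resolution. If `L` is the ideal generated
by the entries of `a₂`, then `I : J = I + L`. -/
theorem colon_eq_sup_comparison
    {R : Type*} [CommRing R] [IsNoetherianRing R] [IsLocalRing R]
    (hreg : ∃ rs : List R, RingTheory.Sequence.IsRegular R rs ∧
      Ideal.span {x | x ∈ rs} = IsLocalRing.maximalIdeal R)
    (f₁ f₂ : R) (hf : RingTheory.Sequence.IsRegular R [f₁, f₂])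
    (I : Ideal R) (hI : I = Ideal.span {f₁, f₂})
    (J : Ideal R) (hJne : J ≠ ⊤) (hJht : idealHeight J = 2) (hIJ : I ≤ J)
    (r m : ℕ)
    (φ₂ : (Fin r → R) →ₗ[R] (Fin m → R)) (φ₁ : (Fin m → R) →ₗ[R] R)
    (hφ₂inj : Function.Injective φ₂)
    (hexact : LinearMap.ker φ₁ = LinearMap.range φ₂)
    (hφ₁range : LinearMap.range φ₁ = J)
    (a₁ : (R × R) →ₗ[R] (Fin m → R)) (a₂ : R →ₗ[R] (Fin r → R))
    (ha₁ : ∀ u v : R, φ₁ (a₁ (u, v)) = f₁ * u + f₂ * v)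
    (ha₂ : ∀ t : R, φ₂ (a₂ t) = a₁ (-(f₂ * t), f₁ * t))
    (L : Ideal R) (hL : L = Ideal.span (Set.range (a₂ 1))) :
    Submodule.colon I J = I ⊔ L := by
  have hw := hf.toIsWeaklyRegular
  have hreg₁ : IsSMulRegular R f₁ :=
    ((RingTheory.Sequence.isWeaklyRegular_cons_iff R f₁ [f₂]).1 hw).1
  have hc : φ₂ (a₂ 1) = a₁ (-f₂, f₁) := by simpa using ha₂ 1
  have hlin : a₁ (-f₂, f₁) = (-f₂) • a₁ (1, 0) + f₁ • a₁ (0, 1) := by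
    rw [← map_smul, ← map_smul, ← map_add]; simp
  have hφ₁φ₂ : ∀ z, φ₁ (φ₂ z) = 0 := fun z =>
    LinearMap.mem_ker.1 (hexact ▸ LinearMap.mem_range_self φ₂ z)
  subst hI hL
  apply le_antisymm
  · intro s hs
    let d₁ : (R × R) →ₗ[R] R := f₁ • LinearMap.fst R R R + f₂ • LinearMap.snd R R R
    let d₂ : R →ₗ[R] R × R := LinearMap.prod (-(f₂ • LinearMap.id)) (f₁ • LinearMap.id)
    obtain ⟨b₁, hb₁⟩ := LinearMap.exists_comp_eq_of_range_le d₁ (s • φ₁) (by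
      rintro _ ⟨w, rfl⟩
      have hw : φ₁ w ∈ J := hφ₁range ▸ LinearMap.mem_range_self φ₁ w
      obtain ⟨p, q, hpq⟩ := Ideal.mem_span_pair.1 (Submodule.mem_colon.1 hs _ hw)
      refine ⟨(p, q), ?_⟩
      simp only [smul_eq_mul] at hpq
      simp only [d₁, LinearMap.add_apply, LinearMap.smul_apply, LinearMap.fst_apply,
        LinearMap.snd_apply, smul_eq_mul]
      linear_combination hpq)
    replace hb₁ : ∀ w, f₁ * (b₁ w).1 + f₂ * (b₁ w).2 = s * φ₁ w := hb₁
    obtain ⟨b₂, hb₂⟩ := LinearMap.exists_comp_eq_of_range_le d₂ (b₁ ∘ₗ φ₂) (by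
      rintro _ ⟨z, rfl⟩
      obtain ⟨t, h₁, h₂⟩ := hw.exists_eq_neg_mul_and_eq_mul
        ((hb₁ (φ₂ z)).trans (by rw [hφ₁φ₂, mul_zero]))
      exact ⟨t, Prod.ext h₁.symm h₂.symm⟩)
    have hhom : ∀ p q : R, ∃ t, s * q - (b₁ (a₁ (p, q))).2 = f₁ * t := fun p q =>
      (hw.exists_eq_neg_mul_and_eq_mul (p := s * p - (b₁ (a₁ (p, q))).1)
        (by linear_combination -hb₁ (a₁ (p, q)) - s * ha₁ p q)).imp fun _ h => h.2
    obtain ⟨t₁, ht₁⟩ := hhom 1 0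
    obtain ⟨t₂, ht₂⟩ := hhom 0 1
    have hb₂c : f₁ * b₂ (a₂ 1) = -f₂ * (b₁ (a₁ (1, 0))).2 + f₁ * (b₁ (a₁ (0, 1))).2 := by
      have h := congrArg Prod.snd (hb₂ (a₂ 1))
      simpa [d₂, hc, hlin] using h
    have hs' : s = (t₂ * f₁ + (-t₁) * f₂) + b₂ (a₂ 1) := hreg₁ (by
      simp only [smul_eq_mul]
      linear_combination f₁ * ht₂ - f₂ * ht₁ - hb₂c)
    rw [hs']
    refine Submodule.add_mem_sup (Ideal.mem_span_pair.2 ⟨_, _, rfl⟩) ?_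
    rw [LinearMap.pi_apply_eq_sum_univ b₂]
    exact Ideal.sum_mem _ fun k _ =>
      Ideal.mul_mem_right _ _ (Ideal.subset_span (Set.mem_range_self k))
  · refine sup_le (fun x hx => Submodule.mem_colon.2 fun y _ => Ideal.mul_mem_right _ _ hx)
      (Ideal.span_le.2 ?_)
    rintro _ ⟨k, rfl⟩
    refine Submodule.mem_colon.2 fun x hx => ?_
    obtain ⟨v, rfl⟩ : x ∈ LinearMap.range φ₁ := hφ₁range ▸ hx
    obtain ⟨h, hh⟩ := LinearMap.exists_comp_eq_of_range_le φ₂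
      (φ₁ v • LinearMap.id - φ₁.smulRight v) (by
        rw [← hexact]
        rintro _ ⟨w, rfl⟩
        simp [mul_comm])
    have hx : φ₁ v • a₂ 1 = h (a₁ (-f₂, f₁)) := hφ₂inj (by
      rw [← hc, hh]
      simp [hφ₁φ₂])
    rw [hlin, map_add, map_smul, map_smul] at hx
    have hk := congrFun hx k
    simp only [Pi.add_apply, Pi.smul_apply, smul_eq_mul] at hk
    refine Ideal.mem_span_pair.2 ⟨h (a₁ (0, 1)) k, -h (a₁ (1, 0)) k, ?_⟩
    simp only [smul_eq_mul]
    linear_combination -hk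
end

section
/- Let R be a commutative Noetherian regular local ring, let f₁, f₂ ∈ R be a regular sequence and I = (f₁, f₂). Let J be a proper ideal of R of height 2 with I ⊆ J, and suppose R⧸J admits a free resolution of length 2: R-linear maps φ₂ : R^r → R^m and φ₁ : R^m → R such that φ₂ is injective, the kernel of φ₁ equals the range of φ₂, and the range of φ₁ equals J. Suppose a₁ : R² → R^m and a₂ : R → R^r are R-linear maps satisfying φ₁(a₁(u, v)) = f₁·u + f₂·v for all u, v ∈ R, and φ₂(a₂(t)) = a₁(−f₂·t, f₁·t) for all t ∈ R. Denote by α₁, …, α_r ∈ R the coordinates of a₂(1). Then for every h ∈ R: h ∈ J if and only if h·α_i ∈ I for all i = 1, …, r. -/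
/-- For a regular sequence `f₁, f₂`, a relation `f₁ • y = f₂ • x` between vectors forces `x` to
be divisible by `f₁`. -/
theorem exists_smul_eq_of_smul_eq_smul {R : Type*} [CommRing R] {f₁ f₂ : R}
    (hf : RingTheory.Sequence.IsRegular R [f₁, f₂]) {ι : Type*} {x y : ι → R}
    (hxy : f₁ • y = f₂ • x) : ∃ z : ι → R, x = f₁ • z := by
  have hf₂ := ((RingTheory.Sequence.isWeaklyRegular_cons_iff R f₁ [f₂]).1 hf.1).2
  rw [RingTheory.Sequence.isWeaklyRegular_singleton_iff] at hf₂
  have key (i : ι) : ∃ z, x i = f₁ * z := by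
    have hx : (Submodule.Quotient.mk (x i) : QuotSMulTop f₁ R) = 0 := by
      refine hf₂ ?_
      change f₂ • (Submodule.Quotient.mk (x i) : QuotSMulTop f₁ R) = f₂ • 0
      rw [smul_zero, ← Submodule.Quotient.mk_smul, Submodule.Quotient.mk_eq_zero,
        show f₂ • x i = f₁ • y i from (congrFun hxy i).symm]
      exact Submodule.smul_mem_pointwise_smul _ _ _ trivial
    rw [Submodule.Quotient.mk_eq_zero, Submodule.mem_smul_pointwise_iff_exists] at hx
    obtain ⟨z, -, hz⟩ := hx
    exact ⟨z, hz.symm⟩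
  choose z hz using key
  exact ⟨z, funext hz⟩

/-- **Algebraic core of Theorem 1.1 of the paper, codimension 2 case.**
With `J` Cohen-Macaulay of codimension `2` with free resolution
`0 → R^r → R^m → R → R⧸J → 0`, `I = (f₁, f₂) ⊆ J` a complete intersection,
and comparison morphism `a₁, a₂` with entries `α₁, …, α_r` of `a₂(1)`,
membership `h ∈ J` is equivalent to `h·αᵢ ∈ I` for all `i`. -/
theorem mem_iff_comparison_entries_smul_mem
    {R : Type*} [CommRing R] [IsNoetherianRing R] [IsLocalRing R]
    (hreg : ∃ rs : List R, RingTheory.Sequence.IsRegular R rs ∧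
      Ideal.span {x | x ∈ rs} = IsLocalRing.maximalIdeal R)
    (f₁ f₂ : R) (hf : RingTheory.Sequence.IsRegular R [f₁, f₂])
    (I : Ideal R) (hI : I = Ideal.span {f₁, f₂})
    (J : Ideal R) (hJne : J ≠ ⊤) (hJht : idealHeight J = 2) (hIJ : I ≤ J)
    (r m : ℕ)
    (φ₂ : (Fin r → R) →ₗ[R] (Fin m → R)) (φ₁ : (Fin m → R) →ₗ[R] R)
    (hφ₂inj : Function.Injective φ₂)
    (hexact : LinearMap.ker φ₁ = LinearMap.range φ₂)
    (hφ₁range : LinearMap.range φ₁ = J)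
    (a₁ : (R × R) →ₗ[R] (Fin m → R)) (a₂ : R →ₗ[R] (Fin r → R))
    (ha₁ : ∀ u v : R, φ₁ (a₁ (u, v)) = f₁ * u + f₂ * v)
    (ha₂ : ∀ t : R, φ₂ (a₂ t) = a₁ (-(f₂ * t), f₁ * t))
    (h : R) :
    h ∈ J ↔ ∀ i : Fin r, h * a₂ 1 i ∈ I := by
  have hf₁ : IsSMulRegular R f₁ :=
    ((RingTheory.Sequence.isWeaklyRegular_cons_iff R f₁ [f₂]).1 hf.1).1
  have hb₁ : φ₁ (a₁ (1, 0)) = f₁ := by simp [ha₁]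
  have hb₂ : φ₁ (a₁ (0, 1)) = f₂ := by simp [ha₁]
  have ha : φ₂ (a₂ 1) = f₁ • a₁ (0, 1) - f₂ • a₁ (1, 0) := by
    rw [ha₂, ← map_smul, ← map_smul, ← map_sub]
    simp
  have hφ (c : Fin r → R) : φ₁ (φ₂ c) = 0 := by
    rw [← LinearMap.mem_ker, hexact]
    exact ⟨c, rfl⟩
  subst hI
  simp only [Ideal.mem_span_pair]
  constructor
  · intro hJ
    rw [← hφ₁range] at hJ
    obtain ⟨x, rfl⟩ := hJ
    have lift (b : Fin m → R) : ∃ c, φ₂ c = φ₁ x • b - φ₁ b • x := by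
      rw [← LinearMap.mem_range, ← hexact, LinearMap.mem_ker]
      simp [mul_comm]
    obtain ⟨c₁, hc₁⟩ := lift (a₁ (1, 0))
    obtain ⟨c₂, hc₂⟩ := lift (a₁ (0, 1))
    rw [hb₁] at hc₁
    rw [hb₂] at hc₂
    have hc : φ₁ x • a₂ 1 = f₁ • c₂ - f₂ • c₁ := by
      apply hφ₂inj
      rw [map_sub, map_smul, map_smul, map_smul, ha, hc₁, hc₂]
      module
    intro i
    refine ⟨c₂ i, -c₁ i, ?_⟩
    have := congrFun hc i
    simp only [Pi.smul_apply, Pi.sub_apply, smul_eq_mul] at this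
    rw [this]
    ring
  · intro hI
    choose c d hcd using hI
    have hc : h • a₂ 1 = f₁ • c + f₂ • d := by
      ext i
      simp only [Pi.smul_apply, Pi.add_apply, smul_eq_mul, ← hcd]
      ring
    have hrel : f₁ • (h • a₁ (0, 1) - φ₂ c) = f₂ • (h • a₁ (1, 0) + φ₂ d) := by
      have := congrArg φ₂ hc
      rw [map_add, map_smul, map_smul, map_smul, ha] at this
      linear_combination (norm := module) this
    obtain ⟨x, hx⟩ := exists_smul_eq_of_smul_eq_smul hf hrel
    have hh : f₁ • h = f₁ • φ₁ x := by
      have := congrArg φ₁ hx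
      rw [map_add, map_smul, map_smul, hφ, hb₁, add_zero] at this
      rw [← this, smul_eq_mul, smul_eq_mul, mul_comm]
    have hmem : h ∈ LinearMap.range φ₁ := ⟨x, (hf₁ hh).symm⟩
    rwa [hφ₁range] at hmem
end

section
/- Let R = ℂ[x, y, z], let φ₂ : R² → R³ be the R-linear map given by the 3 × 2 matrix with columns (−z, −y, x) and (−x², −z, y), i.e. φ₂(u, v) = (−z·u − x²·v, −y·u − z·v, x·u + y·v), and let φ₁ : R³ → R be given by φ₁(a, b, c) = (y² − x·z)·a + (x³ − y·z)·b + (x²·y − z²)·c. Then: φ₂ is injective, the kernel of φ₁ equals the range of φ₂, and the range of φ₁ equals the ideal J = (y² − x·z, x³ − y·z, x²·y − z²). In particular 0 → R² → R³ → R → R⧸J → 0 is a free resolution of R⧸J of length 2. -/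
open MvPolynomial

noncomputable section

local notation "R" => MvPolynomial (Fin 3) ℂ

/-- `φ₂ : R² → R³`, given by the 3 × 2 matrix with columns `(−z, −y, x)` and
`(−x², −z, y)`. -/
def resPhi2 : (Fin 2 → R) →ₗ[R] (Fin 3 → R) :=
  Matrix.mulVecLin !![-X 2, -(X 0 ^ 2); -X 1, -X 2; X 0, X 1]

/-- `φ₁ : R³ → R`, `(a, b, c) ↦ (y² − xz)a + (x³ − yz)b + (x²y − z²)c`. -/
def resPhi1 : (Fin 3 → R) →ₗ[R] R :=
  (LinearMap.proj 0).comp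
    (Matrix.mulVecLin !![X 1 ^ 2 - X 0 * X 2, X 0 ^ 3 - X 1 * X 2,
      X 0 ^ 2 * X 1 - X 2 ^ 2])

namespace MvPolynomial

/-- A variable outside `s` is a nonzerodivisor modulo the ideal generated by the variables
in `s`. -/
theorem mem_span_X_image_of_mul_X_mem {σ S : Type*} [CommRing S] {s : Set σ} {k : σ}
    (hk : k ∉ s) {p : MvPolynomial σ S}
    (h : p * X k ∈ Ideal.span (X '' s : Set (MvPolynomial σ S))) :
    p ∈ Ideal.span (X '' s : Set (MvPolynomial σ S)) := by
  rw [mem_ideal_span_X_image] at h ⊢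
  intro m hm
  obtain ⟨i, hi, hne⟩ := h (m + Finsupp.single k 1) (by
    rw [mem_support_iff, coeff_mul_X]
    exact mem_support_iff.mp hm)
  have hki : k ≠ i := fun e => hk (e ▸ hi)
  refine ⟨i, hi, ?_⟩
  simpa [Finsupp.single_apply, hki] using hne

end MvPolynomial

theorem irreducible_X_one_sq_sub : Irreducible ((X 1 : R) ^ 2 - X 0 * X 2) := by
  have hrel : IsRelPrime (-X 0 : R) (X 1 ^ 2) := by
    rw [IsRelPrime.neg_left_iff]
    refine (X_prime : Prime (X 0 : R)).irreducible.isRelPrime_iff_not_dvd.mpr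
      fun h => ?_
    have h' := X_prime.dvd_of_dvd_pow h
    rw [X_dvd_X] at h'
    exact absurd h' (by decide)
  have h2 : (2 : Fin 3) ∉ ((X 1 : R) ^ 2).vars := fun h => by
    have := vars_pow _ _ h
    simp [vars_X] at this
  have := irreducible_mul_X_add (-X 0 : R) (X 1 ^ 2) 2 (neg_ne_zero.mpr (X_ne_zero _))
    (by simp [vars_neg, vars_X]) h2 hrel
  convert this using 1
  ring

theorem isRelPrime_X_one_sq_sub_X_zero_pow_sub :
    IsRelPrime ((X 1 : R) ^ 2 - X 0 * X 2) (X 0 ^ 3 - X 1 * X 2) := by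
  refine irreducible_X_one_sq_sub.isRelPrime_iff_not_dvd.mpr fun h => ?_
  have h' := map_dvd (eval (![1, -1, 1] : Fin 3 → ℂ)) h
  simp at h'

theorem resPhi1_apply (w : Fin 3 → R) :
    resPhi1 w = (X 1 ^ 2 - X 0 * X 2) * w 0 + (X 0 ^ 3 - X 1 * X 2) * w 1 +
      (X 0 ^ 2 * X 1 - X 2 ^ 2) * w 2 := by
  simp [resPhi1, Matrix.mulVec, dotProduct, Fin.sum_univ_three]

theorem resPhi2_apply (w : Fin 2 → R) :
    resPhi2 w = ![-X 2 * w 0 - X 0 ^ 2 * w 1, -X 1 * w 0 - X 2 * w 1,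
      X 0 * w 0 + X 1 * w 1] := by
  ext i : 1
  fin_cases i <;> simp [resPhi2, Matrix.mulVec, dotProduct, Fin.sum_univ_two] <;> ring

theorem resPhi2_injective : Function.Injective resPhi2 := by
  rw [injective_iff_map_eq_zero]
  intro w hw
  rw [resPhi2_apply] at hw
  have h1 : -X 1 * w 0 - X 2 * w 1 = 0 := congrFun hw 1
  have h2 : X 0 * w 0 + X 1 * w 1 = 0 := congrFun hw 2
  have hf := irreducible_X_one_sq_sub.ne_zero
  have hw0 : w 0 = 0 := (mul_eq_zero.mp (show (X 1 ^ 2 - X 0 * X 2) * w 0 = 0 by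
    linear_combination -X 1 * h1 - X 2 * h2)).resolve_left hf
  have hw1 : w 1 = 0 := (mul_eq_zero.mp (show (X 1 ^ 2 - X 0 * X 2) * w 1 = 0 by
    linear_combination X 0 * h1 + X 1 * h2)).resolve_left hf
  ext i : 1
  fin_cases i
  · exact hw0
  · exact hw1

/-- The third component of a syzygy lies in the ideal `(x, y)`. -/
theorem exists_eq_of_resPhi1_eq_zero {w : Fin 3 → R} (hw : resPhi1 w = 0) :
    ∃ u v : R, u * X 0 + v * X 1 = w 2 := by
  rw [resPhi1_apply] at hw
  have hk : (2 : Fin 3) ∉ ({0, 1} : Set (Fin 3)) := by simp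
  have hmem : w 2 * X 2 * X 2 ∈ Ideal.span (X '' ({0, 1} : Set (Fin 3)) : Set R) := by
    rw [Set.image_pair, Ideal.mem_span_pair]
    exact ⟨-X 2 * w 0 + X 0 ^ 2 * w 1 + X 0 * X 1 * w 2, X 1 * w 0 - X 2 * w 1,
      by linear_combination hw⟩
  have := mem_span_X_image_of_mul_X_mem hk (mem_span_X_image_of_mul_X_mem hk hmem)
  rwa [Set.image_pair, Ideal.mem_span_pair] at this

theorem ker_resPhi1 : LinearMap.ker resPhi1 = LinearMap.range resPhi2 := by
  ext w
  rw [LinearMap.mem_ker, LinearMap.mem_range]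
  constructor
  · intro hw
    obtain ⟨u, v, huv⟩ := exists_eq_of_resPhi1_eq_zero hw
    rw [resPhi1_apply] at hw
    have hsub : (X 1 ^ 2 - X 0 * X 2) * (w 0 + X 2 * u + X 0 ^ 2 * v) +
        (X 0 ^ 3 - X 1 * X 2) * (w 1 + X 1 * u + X 2 * v) = 0 := by
      linear_combination hw + (X 0 ^ 2 * X 1 - X 2 ^ 2) * huv
    have hdvd : (X 1 ^ 2 - X 0 * X 2 : R) ∣
        (X 0 ^ 3 - X 1 * X 2) * (w 1 + X 1 * u + X 2 * v) :=
      ⟨-(w 0 + X 2 * u + X 0 ^ 2 * v), by linear_combination hsub⟩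
    obtain ⟨t, ht⟩ := isRelPrime_X_one_sq_sub_X_zero_pow_sub.dvd_of_dvd_mul_left hdvd
    have h0 : w 0 + X 2 * u + X 0 ^ 2 * v + (X 0 ^ 3 - X 1 * X 2) * t = 0 :=
      (mul_eq_zero.mp (show (X 1 ^ 2 - X 0 * X 2) *
          (w 0 + X 2 * u + X 0 ^ 2 * v + (X 0 ^ 3 - X 1 * X 2) * t) = 0 by
        linear_combination hsub - (X 0 ^ 3 - X 1 * X 2) * ht)).resolve_left
        irreducible_X_one_sq_sub.ne_zero
    refine ⟨![u - X 1 * t, v + X 0 * t], ?_⟩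
    rw [resPhi2_apply]
    ext i : 1
    fin_cases i <;> simp
    · linear_combination -h0
    · linear_combination -ht
    · linear_combination huv
  · rintro ⟨v, rfl⟩
    rw [resPhi1_apply, resPhi2_apply]
    simp
    ring

theorem range_resPhi1 :
    LinearMap.range resPhi1 =
      Ideal.span {(X 1 : R) ^ 2 - X 0 * X 2, X 0 ^ 3 - X 1 * X 2,
        X 0 ^ 2 * X 1 - X 2 ^ 2} := by
  ext p
  rw [LinearMap.mem_range, Ideal.span, Submodule.mem_span_triple]
  constructor
  · rintro ⟨w, rfl⟩
    exact ⟨w 0, w 1, w 2, by rw [resPhi1_apply]; simp only [smul_eq_mul]; ring⟩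
  · rintro ⟨a, b, c, rfl⟩
    refine ⟨![a, b, c], ?_⟩
    rw [resPhi1_apply]
    simp
    ring

/-- The complex `0 → R² → R³ → R → R⧸J → 0` given by `φ₂` and `φ₁` is a free
resolution of length 2 of `R⧸J` for `J = (y² − xz, x³ − yz, x²y − z²)`:
`φ₂` is injective, `ker φ₁ = range φ₂`, and `range φ₁ = J`. -/
theorem free_resolution_monomial_curve :
    Function.Injective resPhi2 ∧
    LinearMap.ker resPhi1 = LinearMap.range resPhi2 ∧
    LinearMap.range resPhi1 =
      Ideal.span {(X 1 : R) ^ 2 - X 0 * X 2, X 0 ^ 3 - X 1 * X 2,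
        X 0 ^ 2 * X 1 - X 2 ^ 2} :=
  ⟨resPhi2_injective, ker_resPhi1, range_resPhi1⟩

end
end

section
/- The set {(x, y, z) ∈ ℂ³ : z² = x²·y and x⁴ + y³ = 2·x·y·z} equals the set {(t³, t⁴, t⁵) : t ∈ ℂ}. (In other words, the common zero set of f₁ = z² − x²y and f₂ = x⁴ + y³ − 2xyz in ℂ³ is exactly the monomial curve parametrized by t ↦ (t³, t⁴, t⁵), so this curve is a set-theoretic complete intersection.) -/
/-- The common zero set in `ℂ³` of `z² − x²y` and `x⁴ + y³ − 2xyz` is exactly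
the monomial curve `{(t³, t⁴, t⁵) : t ∈ ℂ}`, i.e. this curve is a set-theoretic
complete intersection. -/
theorem zero_set_eq_monomial_curve :
    {p : ℂ × ℂ × ℂ | p.2.2 ^ 2 = p.1 ^ 2 * p.2.1 ∧
        p.1 ^ 4 + p.2.1 ^ 3 = 2 * p.1 * p.2.1 * p.2.2} =
      {q : ℂ × ℂ × ℂ | ∃ t : ℂ, q = (t ^ 3, t ^ 4, t ^ 5)} := by
  ext ⟨x, y, z⟩
  simp only [Set.mem_ofPred_eq, Prod.mk.injEq]
  constructor
  · rintro ⟨h₁, h₂⟩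
    by_cases hx : x = 0
    · subst hx
      have hz : z = 0 := by simpa using h₁
      have hy : y = 0 := by simpa using h₂
      exact ⟨0, by simp, by simp [hy], by simp [hz]⟩
    · obtain ⟨s, rfl⟩ : ∃ s, z = x * s := ⟨z / x, by field_simp⟩
      obtain rfl : y = s ^ 2 :=
        mul_left_cancel₀ (pow_ne_zero 2 hx) (by linear_combination -h₁)
      have hxs : x ^ 2 = s ^ 3 :=
        sub_eq_zero.mp (pow_eq_zero_iff two_ne_zero |>.mp (by linear_combination h₂))
      have hs : s ≠ 0 := by
        rintro rfl
        exact hx (by simpa using hxs)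
      obtain ⟨t, rfl⟩ : ∃ t, x = t * s := ⟨x / s, by field_simp⟩
      obtain rfl : s = t ^ 2 :=
        mul_left_cancel₀ (pow_ne_zero 2 hs) (by linear_combination -hxs)
      exact ⟨t, by ring, by ring, by ring⟩
  · rintro ⟨t, rfl, rfl, rfl⟩
    constructor <;> ring
end

section
/- In R = ℂ[x, y, z], the pair f₁ = z² − x²·y, f₂ = x⁴ + y³ − 2·x·y·z is a regular sequence (so I = (f₁, f₂) is a complete intersection ideal of codimension 2), and I is contained in the ideal J = (y² − x·z, x³ − y·z, x²·y − z²). -/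
open MvPolynomial

/-- If `f` is prime, `g` is not a multiple of `f`, and `f`, `g` generate a proper ideal, then
`f, g` is a regular sequence. -/
lemma isRegular_pair_of_prime {R : Type*} [CommRing R] [IsDomain R] {f g : R} (hf : Prime f)
    (hfg : ¬ f ∣ g) (hne : Ideal.span {f, g} ≠ ⊤) :
    RingTheory.Sequence.IsRegular R [f, g] := by
  refine ⟨⟨?_⟩, ?_⟩
  · intro i hi
    rw [isSMulRegular_quotient_iff_mem_of_smul_mem]
    intro x hx
    have hi' : i < 2 := hi
    interval_cases i
    · simpa [hf.ne_zero] using hx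
    · have hx' : f ∣ g * x := by simpa [Ideal.mem_span_singleton] using hx
      simpa [Ideal.mem_span_singleton] using (hf.dvd_or_dvd hx').resolve_left hfg
  · simpa [Ideal.span_insert] using hne.symm

lemma prime_sq_sub_sq_mul :
    Prime ((X 2 : MvPolynomial (Fin 3) ℂ) ^ 2 - X 0 ^ 2 * X 1) := by
  have hrel : IsRelPrime (-(X 0 : MvPolynomial (Fin 3) ℂ) ^ 2) (X 2 ^ 2) := by
    refine IsRelPrime.neg_left (IsRelPrime.pow ?_)
    refine ((X_prime (i := 0)).irreducible.isRelPrime_iff_not_dvd).2 fun h => ?_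
    simp [X_dvd_X] at h
  have hvars (j : Fin 3) (hj : j ≠ 1) : 1 ∉ (X j ^ 2 : MvPolynomial (Fin 3) ℂ).vars := by
    intro h
    have h' := vars_pow _ _ h
    rw [vars_X, Finset.mem_singleton] at h'
    exact hj h'.symm
  have h := irreducible_mul_X_add (-(X 0 : MvPolynomial (Fin 3) ℂ) ^ 2) (X 2 ^ 2) 1
    (by simp) (by rw [vars_neg]; exact hvars 0 (by decide)) (hvars 2 (by decide)) hrel
  rw [show (X 2 : MvPolynomial (Fin 3) ℂ) ^ 2 - X 0 ^ 2 * X 1 =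
    -X 0 ^ 2 * X 1 + X 2 ^ 2 by ring]
  exact h.prime

/-- In `R = ℂ[x, y, z]`, the pair `f₁ = z² − x²y`, `f₂ = x⁴ + y³ − 2xyz` is a
regular sequence, and the complete intersection ideal `I = (f₁, f₂)` is
contained in `J = (y² − xz, x³ − yz, x²y − z²)`. -/
theorem regular_sequence_and_contained :
    RingTheory.Sequence.IsRegular (MvPolynomial (Fin 3) ℂ)
      [(X 2 : MvPolynomial (Fin 3) ℂ) ^ 2 - X 0 ^ 2 * X 1,
        X 0 ^ 4 + X 1 ^ 3 - 2 * X 0 * X 1 * X 2] ∧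
    Ideal.span {(X 2 : MvPolynomial (Fin 3) ℂ) ^ 2 - X 0 ^ 2 * X 1,
        X 0 ^ 4 + X 1 ^ 3 - 2 * X 0 * X 1 * X 2} ≤
      Ideal.span {(X 1 : MvPolynomial (Fin 3) ℂ) ^ 2 - X 0 * X 2,
        X 0 ^ 3 - X 1 * X 2, X 0 ^ 2 * X 1 - X 2 ^ 2} := by
  refine ⟨isRegular_pair_of_prime prime_sq_sub_sq_mul ?_ ?_, ?_⟩
  · intro h
    have h' := map_dvd (eval ![(1 : ℂ), 1, -1]) h
    norm_num [show ![(1 : ℂ), 1, -1] 2 = -1 from rfl] at h'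
  · intro h
    have hle : Ideal.span {(X 2 : MvPolynomial (Fin 3) ℂ) ^ 2 - X 0 ^ 2 * X 1,
        X 0 ^ 4 + X 1 ^ 3 - 2 * X 0 * X 1 * X 2} ≤ RingHom.ker (eval (0 : Fin 3 → ℂ)) := by
      rw [Ideal.span_le]
      rintro p (rfl | rfl) <;> simp [RingHom.mem_ker]
    exact RingHom.ker_ne_top _ (top_le_iff.1 (h ▸ hle))
  · rw [Ideal.span_le]
    rintro p (rfl | rfl)
    · exact Ideal.mem_span_insert.2 ⟨0, _, Ideal.mem_span_pair.2 ⟨0, -1, rfl⟩, by ring⟩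
    · exact Ideal.mem_span_insert.2 ⟨X 1, _, Ideal.mem_span_pair.2 ⟨X 0, 0, rfl⟩, by ring⟩
end

section
/- In R = ℂ[x, y, z], let J = (y² − x·z, x³ − y·z, x²·y − z²) and I = (z² − x²·y, x⁴ + y³ − 2·x·y·z). Then the radical of I equals J. -/
open MvPolynomial

/-- The parametrization `x ↦ t³, y ↦ t⁴, z ↦ t⁵` of the monomial curve. -/
noncomputable def monomialCurveParam (K : Type*) [CommRing K] :
    MvPolynomial (Fin 3) K →ₐ[K] Polynomial K :=
  aeval ![Polynomial.X ^ 3, Polynomial.X ^ 4, Polynomial.X ^ 5]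

/-- The ideal `(y² − xz, x³ − yz, x²y − z²)`. -/
noncomputable def monomialCurveIdeal (K : Type*) [CommRing K] : Ideal (MvPolynomial (Fin 3) K) :=
  Ideal.span {X 1 ^ 2 - X 0 * X 2, X 0 ^ 3 - X 1 * X 2, X 0 ^ 2 * X 1 - X 2 ^ 2}

/-- Modulo the ideal of the curve, `1, y, z` generate `K[x, y, z]` as a `K[x]`-module. -/
theorem exists_sub_mem_monomialCurveIdeal {K : Type*} [CommRing K] (p : MvPolynomial (Fin 3) K) :
    ∃ q r s : Polynomial K, p - (Polynomial.aeval (X 0) q + X 1 * Polynomial.aeval (X 0) r +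
      X 2 * Polynomial.aeval (X 0) s) ∈ monomialCurveIdeal K := by
  induction p using MvPolynomial.induction_on with
  | C a => exact ⟨Polynomial.C a, 0, 0, by simp [MvPolynomial.algebraMap_eq]⟩
  | add p₁ p₂ h₁ h₂ =>
    obtain ⟨q₁, r₁, s₁, h₁⟩ := h₁
    obtain ⟨q₂, r₂, s₂, h₂⟩ := h₂
    refine ⟨q₁ + q₂, r₁ + r₂, s₁ + s₂, ?_⟩
    convert add_mem h₁ h₂ using 1
    simp only [map_add]
    ring
  | mul_X p i h =>
    obtain ⟨q, r, s, h⟩ := h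
    have h₁ : X 1 ^ 2 - X 0 * X 2 ∈ monomialCurveIdeal K := Ideal.subset_span (by simp)
    have h₂ : X 0 ^ 3 - X 1 * X 2 ∈ monomialCurveIdeal K := Ideal.subset_span (by simp)
    have h₃ : X 0 ^ 2 * X 1 - X 2 ^ 2 ∈ monomialCurveIdeal K := Ideal.subset_span (by simp)
    have h := Ideal.mul_mem_left _ (X i) h
    fin_cases i
    · refine ⟨Polynomial.X * q, Polynomial.X * r, Polynomial.X * s, ?_⟩
      convert h using 1
      simp only [map_mul, Polynomial.aeval_X, Fin.zero_eta]
      ring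
    · refine ⟨Polynomial.X ^ 3 * s, q, Polynomial.X * r, ?_⟩
      convert sub_mem (add_mem h (Ideal.mul_mem_left _ (Polynomial.aeval (X 0) r) h₁))
        (Ideal.mul_mem_left _ (Polynomial.aeval (X 0) s) h₂) using 1
      simp only [map_mul, map_pow, Polynomial.aeval_X, Fin.mk_one]
      ring
    · refine ⟨Polynomial.X ^ 3 * r, Polynomial.X ^ 2 * s, q, ?_⟩
      convert sub_mem (sub_mem h (Ideal.mul_mem_left _ (Polynomial.aeval (X 0) r) h₂))
        (Ideal.mul_mem_left _ (Polynomial.aeval (X 0) s) h₃) using 1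
      simp only [map_mul, map_pow, Polynomial.aeval_X, Fin.reduceFinMk]
      ring

theorem monomialCurveParam_aeval_X_zero {K : Type*} [CommRing K] (q : Polynomial K) :
    monomialCurveParam K (Polynomial.aeval (X 0) q) = Polynomial.expand K 3 q := by
  rw [← Polynomial.aeval_algHom_apply, Polynomial.expand_eq_sum, Polynomial.aeval_eq_sum_range,
    Polynomial.sum_over_range _ (by simp)]
  simp [monomialCurveParam, Polynomial.smul_eq_C_mul]

/-- The `K[t³]`-module `K[t]` contains `1, t⁴, t⁵` as linearly independent elements. -/
theorem eq_zero_of_expand_three_add_eq_zero {K : Type*} [CommRing K] {q r s : Polynomial K}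
    (h : Polynomial.expand K 3 q + Polynomial.X ^ 4 * Polynomial.expand K 3 r +
      Polynomial.X ^ 5 * Polynomial.expand K 3 s = 0) : q = 0 ∧ r = 0 ∧ s = 0 := by
  have key (n : ℕ) := congrArg (fun p => Polynomial.coeff p n) h
  simp only [Polynomial.coeff_add, Polynomial.coeff_X_pow_mul', Polynomial.coeff_zero,
    Polynomial.coeff_expand (show 0 < 3 by norm_num)] at key
  refine ⟨?_, ?_, ?_⟩ <;> ext n
  · have := key (3 * n)
    have h₁ : 4 ≤ 3 * n → ¬ 3 ∣ 3 * n - 4 := by lia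
    have h₂ : 5 ≤ 3 * n → ¬ 3 ∣ 3 * n - 5 := by lia
    simpa +contextual [h₁, h₂] using this
  · have := key (3 * n + 4)
    have h₁ : ¬ 3 ∣ 3 * n + 4 := by lia
    have h₂ : 5 ≤ 3 * n + 4 → ¬ 3 ∣ 3 * n + 4 - 5 := by lia
    simpa +contextual [h₁, h₂, -Nat.reduceLeDiff, -Nat.reduceSubDiff] using this
  · have := key (3 * n + 5)
    have h₁ : ¬ 3 ∣ 3 * n + 5 := by lia
    have h₂ : ¬ 3 ∣ 3 * n + 5 - 4 := by lia
    simpa +contextual [h₁, h₂, -Nat.reduceLeDiff, -Nat.reduceSubDiff] using this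

theorem ker_monomialCurveParam (K : Type*) [CommRing K] :
    RingHom.ker (monomialCurveParam K) = monomialCurveIdeal K := by
  have hle : monomialCurveIdeal K ≤ RingHom.ker (monomialCurveParam K) := by
    rw [monomialCurveIdeal, Ideal.span_le]
    rintro p (rfl | rfl | rfl) <;>
      simp only [SetLike.mem_coe, RingHom.mem_ker, monomialCurveParam, map_sub, map_mul, map_pow,
        aeval_X, Matrix.cons_val] <;> ring
  refine le_antisymm (fun p hp => ?_) hle
  obtain ⟨q, r, s, h⟩ := exists_sub_mem_monomialCurveIdeal p
  have h₀ := hle h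
  have hX₁ : monomialCurveParam K (X 1) = Polynomial.X ^ 4 := by simp [monomialCurveParam]
  have hX₂ : monomialCurveParam K (X 2) = Polynomial.X ^ 5 := by simp [monomialCurveParam]
  rw [RingHom.mem_ker] at hp
  rw [RingHom.mem_ker, map_sub, hp, zero_sub, neg_eq_zero] at h₀
  simp only [map_add, map_mul, monomialCurveParam_aeval_X_zero, hX₁, hX₂] at h₀
  obtain ⟨rfl, rfl, rfl⟩ := eq_zero_of_expand_three_add_eq_zero h₀
  simpa using h

theorem monomialCurveIdeal_isPrime (K : Type*) [CommRing K] [IsDomain K] :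
    (monomialCurveIdeal K).IsPrime :=
  ker_monomialCurveParam K ▸ RingHom.ker_isPrime _

/-- In `R = ℂ[x, y, z]`, the radical of `I = (z² − x²y, x⁴ + y³ − 2xyz)`
equals `J = (y² − xz, x³ − yz, x²y − z²)`: the monomial curve `(t³, t⁴, t⁵)`
is a set-theoretic complete intersection. -/
theorem radical_eq_monomial_curve_ideal :
    (Ideal.span {(X 2 : MvPolynomial (Fin 3) ℂ) ^ 2 - X 0 ^ 2 * X 1,
        X 0 ^ 4 + X 1 ^ 3 - 2 * X 0 * X 1 * X 2}).radical =
      Ideal.span {(X 1 : MvPolynomial (Fin 3) ℂ) ^ 2 - X 0 * X 2,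
        X 0 ^ 3 - X 1 * X 2, X 0 ^ 2 * X 1 - X 2 ^ 2} := by
  refine le_antisymm ((monomialCurveIdeal_isPrime ℂ).isRadical.radical_le_iff.2 ?_) ?_
  · rw [Ideal.span_le]
    rintro p (rfl | rfl)
    · exact (Ideal.mem_span_insert' _ _ _).2 ⟨0, Ideal.mem_span_pair.2 ⟨0, -1, by ring⟩⟩
    · exact (Ideal.mem_span_insert' _ _ _).2 ⟨-X 1, Ideal.mem_span_pair.2 ⟨X 0, 0, by ring⟩⟩
  · rw [Ideal.span_le]
    rintro p (rfl | rfl | rfl)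
    · exact ⟨2, Ideal.mem_span_pair.2 ⟨X 0 ^ 2, X 1, by ring⟩⟩
    · exact ⟨2, Ideal.mem_span_pair.2 ⟨X 1 ^ 2, X 0 ^ 2, by ring⟩⟩
    · exact ⟨1, Ideal.mem_span_pair.2 ⟨-1, 0, by ring⟩⟩
end

section
/- In R = ℂ[x, y, z], let J = (y² − x·z, x³ − y·z, x²·y − z²) and I = (z² − x²·y, x⁴ + y³ − 2·x·y·z). Then the colon ideal I : J equals I + (x³ − y·z, y² − x·z), i.e. I : J = (z² − x²·y, x⁴ + y³ − 2·x·y·z, x³ − y·z, y² − x·z). -/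
open MvPolynomial

/-- The parametrization `t ↦ (t³, t⁴, t⁵)` of the monomial curve, on coordinate rings. -/
noncomputable def monomialCurve : MvPolynomial (Fin 3) ℂ →ₐ[ℂ] Polynomial ℂ :=
  aeval ![Polynomial.X ^ 3, Polynomial.X ^ 4, Polynomial.X ^ 5]

@[simp]
lemma monomialCurve_X_zero : monomialCurve (X 0) = Polynomial.X ^ 3 := by simp [monomialCurve]

@[simp]
lemma monomialCurve_X_one : monomialCurve (X 1) = Polynomial.X ^ 4 := by simp [monomialCurve]

@[simp]
lemma monomialCurve_X_two : monomialCurve (X 2) = Polynomial.X ^ 5 := by simp [monomialCurve]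

/-- Modulo the ideal of the monomial curve, every polynomial lies in the `ℂ[x]`-span of
`1, y, z`. -/
lemma exists_normal_form (J : Ideal (MvPolynomial (Fin 3) ℂ))
    (h₁ : (X 1 : MvPolynomial (Fin 3) ℂ) ^ 2 - X 0 * X 2 ∈ J)
    (h₂ : (X 0 : MvPolynomial (Fin 3) ℂ) ^ 3 - X 1 * X 2 ∈ J)
    (h₃ : (X 0 : MvPolynomial (Fin 3) ℂ) ^ 2 * X 1 - X 2 ^ 2 ∈ J)
    (p : MvPolynomial (Fin 3) ℂ) :
    ∃ a b c : Polynomial ℂ, p - (Polynomial.aeval (X 0) a + Polynomial.aeval (X 0) b * X 1 +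
      Polynomial.aeval (X 0) c * X 2) ∈ J := by
  induction p using MvPolynomial.induction_on with
  | C r => exact ⟨Polynomial.C r, 0, 0, by simp [MvPolynomial.algebraMap_eq]⟩
  | add p q hp hq =>
    obtain ⟨a, b, c, h⟩ := hp
    obtain ⟨a', b', c', h'⟩ := hq
    refine ⟨a + a', b + b', c + c', ?_⟩
    convert J.add_mem h h' using 1
    simp only [map_add]
    ring
  | mul_X p i hp =>
    obtain ⟨a, b, c, h⟩ := hp
    have hX := J.mul_mem_left (X i) h
    fin_cases i
    · refine ⟨a * Polynomial.X, b * Polynomial.X, c * Polynomial.X, ?_⟩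
      convert hX using 1
      simp only [map_mul, Polynomial.aeval_X, Fin.zero_eta]
      ring
    · refine ⟨c * Polynomial.X ^ 3, a, b * Polynomial.X, ?_⟩
      convert J.sub_mem (J.add_mem hX (J.mul_mem_left (Polynomial.aeval (X 0) b) h₁))
        (J.mul_mem_left (Polynomial.aeval (X 0) c) h₂) using 1
      simp only [map_mul, map_pow, Polynomial.aeval_X, Fin.mk_one]
      ring
    · refine ⟨b * Polynomial.X ^ 3, c * Polynomial.X ^ 2, a, ?_⟩
      convert J.sub_mem (J.sub_mem hX (J.mul_mem_left (Polynomial.aeval (X 0) b) h₂))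
        (J.mul_mem_left (Polynomial.aeval (X 0) c) h₃) using 1
      simp only [map_mul, map_pow, Polynomial.aeval_X, Fin.reduceFinMk]
      ring

lemma monomialCurve_aeval_X_zero (a : Polynomial ℂ) :
    monomialCurve (Polynomial.aeval (X 0) a) = Polynomial.expand ℂ 3 a := by
  rw [← Polynomial.aeval_algHom_apply, monomialCurve_X_zero, Polynomial.expand_eq_comp_X_pow,
    Polynomial.comp_eq_aeval]

lemma eq_zero_of_expand_three_add {a b c : Polynomial ℂ}
    (h : Polynomial.expand ℂ 3 a + Polynomial.expand ℂ 3 b * Polynomial.X ^ 4 +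
      Polynomial.expand ℂ 3 c * Polynomial.X ^ 5 = 0) : a = 0 ∧ b = 0 ∧ c = 0 := by
  have hcoeff (n : ℕ) := congrArg (Polynomial.coeff · n) h
  simp only [Polynomial.coeff_add, Polynomial.coeff_mul_X_pow', Polynomial.coeff_zero,
    Polynomial.coeff_expand (by norm_num : 0 < 3)] at hcoeff
  refine ⟨?_, ?_, ?_⟩ <;> ext n
  · have := hcoeff (3 * n)
    rw [if_pos (by omega), Nat.mul_div_cancel_left n (by norm_num)] at this
    simpa [show ¬ (4 ≤ 3 * n ∧ 3 ∣ 3 * n - 4) by omega, ← ite_and,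
      show ¬ (5 ≤ 3 * n ∧ 3 ∣ 3 * n - 5) by omega] using this
  · have := hcoeff (3 * n + 4)
    rw [if_neg (by omega), if_pos (by omega), if_pos (by omega), Nat.add_sub_cancel,
      Nat.mul_div_cancel_left n (by norm_num)] at this
    simpa only [← ite_and, show ¬ (5 ≤ 3 * n + 4 ∧ 3 ∣ 3 * n + 4 - 5) by omega, if_false,
      zero_add, add_zero, Polynomial.coeff_zero] using this
  · have := hcoeff (3 * n + 5)
    rw [if_neg (by omega), if_pos (by omega), if_neg (by omega), if_pos (by omega),
      if_pos (by omega), Nat.add_sub_cancel, Nat.mul_div_cancel_left n (by norm_num)] at this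
    simpa using this

/-- The ideal of the monomial curve `(t³, t⁴, t⁵)` is `(y² - xz, x³ - yz, x²y - z²)`. -/
lemma ker_monomialCurve : RingHom.ker monomialCurve =
    Ideal.span {(X 1 : MvPolynomial (Fin 3) ℂ) ^ 2 - X 0 * X 2,
      X 0 ^ 3 - X 1 * X 2, X 0 ^ 2 * X 1 - X 2 ^ 2} := by
  set J := Ideal.span {(X 1 : MvPolynomial (Fin 3) ℂ) ^ 2 - X 0 * X 2,
    X 0 ^ 3 - X 1 * X 2, X 0 ^ 2 * X 1 - X 2 ^ 2}
  have hle : J ≤ RingHom.ker monomialCurve := by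
    rw [Ideal.span_le]
    rintro _ (rfl | rfl | rfl) <;>
      simp only [SetLike.mem_coe, RingHom.mem_ker, map_sub, map_mul, map_pow,
        monomialCurve_X_zero, monomialCurve_X_one, monomialCurve_X_two] <;> ring
  refine le_antisymm (fun p hp => ?_) hle
  obtain ⟨a, b, c, h⟩ := exists_normal_form J (Ideal.subset_span (by simp))
    (Ideal.subset_span (by simp)) (Ideal.subset_span (by simp)) p
  have h0 := hle h
  rw [RingHom.mem_ker, map_sub, RingHom.mem_ker.1 hp, zero_sub, neg_eq_zero] at h0
  simp only [map_add, map_mul, monomialCurve_aeval_X_zero, monomialCurve_X_one,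
    monomialCurve_X_two] at h0
  obtain ⟨rfl, rfl, rfl⟩ := eq_zero_of_expand_three_add h0
  simpa using h

/-- The derivation `2 ∂/∂y + t ∂/∂z` along the monomial curve kills
`(z² - x²y, x⁴ + y³ - 2xyz)` but not `y² - xz`. -/
lemma monomialCurve_eq_zero_of_mul_mem {r : MvPolynomial (Fin 3) ℂ}
    (hr : r * (X 1 ^ 2 - X 0 * X 2) ∈ Ideal.span
      {(X 2 : MvPolynomial (Fin 3) ℂ) ^ 2 - X 0 ^ 2 * X 1,
        X 0 ^ 4 + X 1 ^ 3 - 2 * X 0 * X 1 * X 2}) : monomialCurve r = 0 := by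
  obtain ⟨a, b, h⟩ := Ideal.mem_span_pair.1 hr
  have h2 (i : Fin 3) : pderiv i (2 : MvPolynomial (Fin 3) ℂ) = 0 := (pderiv i).map_natCast 2
  have hy := congrArg (fun p => monomialCurve (pderiv 1 p)) h
  have hz := congrArg (fun p => monomialCurve (pderiv 2 p)) h
  simp [pderiv_X, h2, map_ofNat monomialCurve, Derivation.leibniz_pow] at hy hz
  have : monomialCurve r * (3 * Polynomial.X ^ 4) = 0 := by
    linear_combination -2 * hy - Polynomial.X * hz
  simpa using this

/-- In `R = ℂ[x, y, z]`, with `J = (y² − xz, x³ − yz, x²y − z²)` and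
`I = (z² − x²y, x⁴ + y³ − 2xyz)`, one has `I : J = I + (x³ − yz, y² − xz)`. -/
theorem colon_eq_span_comparison_entries :
    Submodule.colon
        (Ideal.span {(X 2 : MvPolynomial (Fin 3) ℂ) ^ 2 - X 0 ^ 2 * X 1,
          X 0 ^ 4 + X 1 ^ 3 - 2 * X 0 * X 1 * X 2})
        (Ideal.span {(X 1 : MvPolynomial (Fin 3) ℂ) ^ 2 - X 0 * X 2,
          X 0 ^ 3 - X 1 * X 2, X 0 ^ 2 * X 1 - X 2 ^ 2}) =
      Ideal.span {(X 2 : MvPolynomial (Fin 3) ℂ) ^ 2 - X 0 ^ 2 * X 1,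
          X 0 ^ 4 + X 1 ^ 3 - 2 * X 0 * X 1 * X 2} ⊔
        Ideal.span {(X 0 : MvPolynomial (Fin 3) ℂ) ^ 3 - X 1 * X 2,
          X 1 ^ 2 - X 0 * X 2} := by
  apply le_antisymm
  · intro r hr
    have hmem := Submodule.mem_colon.1 hr _ (Ideal.subset_span (Set.mem_insert _ _))
    have hker := RingHom.mem_ker.2 (monomialCurve_eq_zero_of_mul_mem hmem)
    rw [ker_monomialCurve] at hker
    refine Ideal.span_le.2 ?_ hker
    rintro _ (rfl | rfl | rfl)
    · exact Ideal.mem_sup_right (Ideal.subset_span (by simp))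
    · exact Ideal.mem_sup_right (Ideal.subset_span (by simp))
    · rw [SetLike.mem_coe, ← neg_mem_iff, neg_sub]
      exact Ideal.mem_sup_left (Ideal.subset_span (by simp))
  · refine sup_le Ideal.le_colon (Ideal.span_le.2 ?_)
    rintro _ (rfl | rfl) <;> rw [SetLike.mem_coe, Ideal.colon_span, Submodule.mem_colon] <;>
      rintro _ (rfl | rfl | rfl) <;> rw [smul_eq_mul, Ideal.mem_span_pair]
    · exact ⟨-(X 0 * X 1), -X 2, by ring⟩
    · exact ⟨X 1 ^ 2, X 0 ^ 2, by ring⟩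
    · exact ⟨-(X 0 ^ 3 - X 1 * X 2), 0, by ring⟩
    · exact ⟨X 0 ^ 2, X 1, by ring⟩
    · exact ⟨-(X 0 * X 1), -X 2, by ring⟩
    · exact ⟨-(X 1 ^ 2 - X 0 * X 2), 0, by ring⟩
end
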